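/- Let M be a nonnegative integer, let r_1,…,r_M be positive integers, let s be a positive integer, and set k = s + r_1 + ⋯ + r_M. Then ∑_{n=1}^∞ 2^{2n} [∏_{j=1}^M H_{n-1}^{(r_j)}] / (n^{s+1} · C(2n,n)) belongs to 𝔷_{k+1}(2), and the quadratic analog ∑_{n=1}^∞ 2^{4n} [∏_{j=1}^M H_{n-1}^{(r_j)}] / (n^{s+2} · C(2n,n)²) belongs to 𝔷_{k+2}(4), where C(2n,n) is the central binomial coefficient. -/

import Mathlib

open scoped Real
open MeasureTheory

noncomputable section

/-- Goncharov's multiple polylogarithm. -/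
def MPL {n : ℕ} (a : Fin n → ℕ) (z : Fin n → ℂ) : ℂ :=
  ∑' ℓ : {f : Fin n → ℕ // StrictAnti f ∧ ∀ i, 0 < f i},
    ∏ j, z j ^ (ℓ.1 j) / ((ℓ.1 j : ℂ) ^ (a j))

/-- `x` is a (convergent) multiple polylogarithm value of weight `k` at `N`-th roots of unity. -/
def IsCMZV (k N : ℕ) (x : ℂ) : Prop :=
  ∃ (n : ℕ) (a : Fin (n + 1) → ℕ) (z : Fin (n + 1) → ℂ),
    (∀ j, 0 < a j) ∧ (∀ j, z j ^ N = 1) ∧ (∑ j, a j = k) ∧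
    ¬(a 0 = 1 ∧ z 0 = 1) ∧ x = MPL a z

/-- The ℚ-vector space `𝔷_k(N)`. -/
def zspan (k N : ℕ) : Submodule ℚ ℂ := Submodule.span ℚ {x | IsCMZV k N x}

/-- Harmonic number of order `r`: `H_n^{(r)} = ∑_{k=1}^n 1/k^r`. -/
def H (r n : ℕ) : ℝ := ∑ k ∈ Finset.range n, (1 : ℝ) / (k + 1) ^ r

/-- Alternating harmonic number of order `r`: `H̄_n^{(r)} = ∑_{k=1}^n (-1)^{k-1}/k^r`. -/
def Hbar (r n : ℕ) : ℝ := ∑ k ∈ Finset.range n, (-1 : ℝ) ^ k / (k + 1) ^ r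


/-! ### Combinatorial part -/

def TT (n l : ℕ) : Finset (Fin (n + 1) → ℕ) :=
  by
    classical
    exact (Fintype.piFinset fun _ => Finset.range (l + 1)).filter
      (fun f => (StrictAnti f ∧ ∀ i, 0 < f i) ∧ f 0 = l)

lemma mem_TT {n l : ℕ} {f : Fin (n + 1) → ℕ} :
    f ∈ TT n l ↔ (StrictAnti f ∧ ∀ i, 0 < f i) ∧ f 0 = l := by
  classical
  unfold TT
  simp only [Finset.mem_filter, Fintype.mem_piFinset, Finset.mem_range, and_iff_right_iff_imp]
  rintro ⟨⟨h, _⟩, h0⟩ i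
  have := h.antitone (Fin.zero_le i)
  omega

def Cs {n : ℕ} (a : Fin (n + 1) → ℕ) (z : Fin (n + 1) → ℂ) (l : ℕ) : ℂ :=
  ∑ f ∈ TT n l, ∏ j, z j ^ (f j) / ((f j : ℂ) ^ (a j))

lemma Cs_one (a : Fin 1 → ℕ) (z : Fin 1 → ℂ) (ha : 0 < a 0) (l : ℕ) :
    Cs a z l = z 0 ^ l / (l : ℂ) ^ (a 0) := by
  unfold Cs
  rcases Nat.eq_zero_or_pos l with rfl | hl
  · have : TT 0 0 = ∅ := by
      ext f
      simp only [mem_TT, Finset.notMem_empty, iff_false]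
      rintro ⟨⟨_, h⟩, h0⟩
      have := h 0
      omega
    simp [this, ha.ne']
  · have : TT 0 l = {fun _ => l} := by
      ext f
      simp only [mem_TT, Finset.mem_singleton]
      constructor
      · rintro ⟨_, h0⟩
        funext i
        rw [show i = 0 from Fin.fin_one_eq_zero i, h0]
      · rintro rfl
        exact ⟨⟨fun i j h => by have := i.2; have := j.2; omega, fun _ => hl⟩, rfl⟩
    simp [this]

lemma Cs_succ {n : ℕ} (a : Fin (n + 2) → ℕ) (z : Fin (n + 2) → ℂ) (l : ℕ) :
    Cs a z l = z 0 ^ l / (l : ℂ) ^ (a 0) *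
      ∑ j ∈ Finset.range l, Cs (fun i => a i.succ) (fun i => z i.succ) j := by
  unfold Cs
  rw [Finset.mul_sum]
  simp_rw [Finset.mul_sum]
  rw [Finset.sum_sigma']
  refine Finset.sum_bij' (fun f _ => ⟨f 1, fun i => f i.succ⟩)
    (fun p _ => Matrix.vecCons l p.2) ?_ ?_ ?_ ?_ ?_
  · intro f hf
    rw [mem_TT] at hf
    simp only [Finset.mem_sigma, Finset.mem_range, mem_TT]
    obtain ⟨⟨h1, h2⟩, h3⟩ := hf
    refine ⟨?_, ⟨fun i j hij => h1 (Fin.succ_lt_succ_iff.2 hij), fun i => h2 _⟩, rfl⟩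
    have := h1 (show (0 : Fin (n + 2)) < 1 from Fin.zero_lt_one)
    omega
  · rintro ⟨j, g⟩ hp
    simp only [Finset.mem_sigma, Finset.mem_range, mem_TT] at hp
    obtain ⟨hj, ⟨h1, h2⟩, h3⟩ := hp
    rw [mem_TT]
    refine ⟨⟨strictAnti_vecCons.2 ⟨by change g 0 < l; omega, h1⟩, ?_⟩, rfl⟩
    intro i
    refine Fin.cases ?_ (fun i => ?_) i
    · simp; omega
    · simpa using h2 i
  · intro f hf
    rw [mem_TT] at hf
    funext i
    refine Fin.cases ?_ (fun i => ?_) i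
    · simp [hf.2]
    · simp
  · rintro ⟨j, g⟩ hp
    simp only [Finset.mem_sigma, Finset.mem_range, mem_TT] at hp
    obtain ⟨hj, ⟨h1, h2⟩, h3⟩ := hp
    simp only [Matrix.cons_val_succ, Sigma.mk.injEq, heq_eq_eq, and_true]
    simpa using h3
  · intro f hf
    rw [mem_TT] at hf
    rw [Fin.prod_univ_succ, hf.2]

/-- decay bound -/
def Bd (c : ℕ → ℂ) : Prop := ∃ C : ℝ, 0 ≤ C ∧ ∀ l : ℕ, 0 < l → ‖c l‖ ≤ C / √l

lemma sum_inv_sqrt' (l : ℕ) : ∑ j ∈ Finset.range (l + 1), (1 : ℝ) / √j ≤ 2 * √l := by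
  induction l with
  | zero => simp
  | succ l ih =>
    rw [Finset.sum_range_succ]
    have ha : √((l + 1 : ℕ) : ℝ) ^ 2 = l + 1 := by
      rw [Real.sq_sqrt (by positivity)]; push_cast; ring
    have hb : √(l : ℝ) ^ 2 = l := Real.sq_sqrt (by positivity)
    have h0 : 0 < √((l + 1 : ℕ) : ℝ) := by positivity
    have h1 : 1 / √((l + 1 : ℕ) : ℝ) ≤ 2 * √((l + 1 : ℕ) : ℝ) - 2 * √(l : ℝ) := by
      rw [div_le_iff₀ h0]
      nlinarith [sq_nonneg (√((l + 1 : ℕ) : ℝ) - √(l : ℝ))]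
    linarith

lemma sum_inv_sqrt (l : ℕ) : ∑ j ∈ Finset.range l, (1 : ℝ) / √j ≤ 2 * √l := by
  cases l with
  | zero => simp
  | succ l =>
    refine (sum_inv_sqrt' l).trans ?_
    have : √(l : ℝ) ≤ √((l + 1 : ℕ) : ℝ) := Real.sqrt_le_sqrt (by push_cast; linarith)
    linarith

lemma Bd.sum_div {c : ℕ → ℂ} (hc : Bd c) (h0 : c 0 = 0) (w : ℕ → ℂ) (hw : ∀ l, ‖w l‖ ≤ 1 / (l : ℝ)) :
    Bd (fun l => w l * ∑ j ∈ Finset.range l, c j) := by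
  obtain ⟨C, hC, h⟩ := hc
  refine ⟨2 * C, by positivity, fun l hl => ?_⟩
  have h1 : ‖∑ j ∈ Finset.range l, c j‖ ≤ C * (2 * √l) := by
    calc _ ≤ ∑ j ∈ Finset.range l, ‖c j‖ := norm_sum_le _ _
      _ ≤ ∑ j ∈ Finset.range l, C * (1 / √j) := by
        refine Finset.sum_le_sum fun j _ => ?_
        rcases Nat.eq_zero_or_pos j with rfl | hj
        · simp [h0]
        · have := h j hj
          rwa [mul_one_div]
      _ ≤ _ := by
        rw [← Finset.mul_sum]
        exact mul_le_mul_of_nonneg_left (sum_inv_sqrt l) hC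
  have hl' : (0:ℝ) < l := by exact_mod_cast hl
  rw [norm_mul]
  calc _ ≤ 1 / (l:ℝ) * (C * (2 * √l)) := by
        gcongr
        exact hw l
    _ = 2 * C / √l := by
        have : (l:ℝ) = √l * √l := (Real.mul_self_sqrt hl'.le).symm
        have h2 : √(l:ℝ) ≠ 0 := by positivity
        rw [this, Real.sqrt_mul_self (by positivity)]
        field_simp

lemma Cs_zero {n : ℕ} (a : Fin (n + 1) → ℕ) (z : Fin (n + 1) → ℂ) : Cs a z 0 = 0 := by
  unfold Cs
  have : TT n 0 = ∅ := by
    ext f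
    simp only [mem_TT, Finset.notMem_empty, iff_false]
    rintro ⟨⟨_, h⟩, h0⟩
    have := h 0
    omega
  simp [this]

lemma norm_w (z : ℂ) (hz : ‖z‖ = 1) (a : ℕ) (ha : 0 < a) (l : ℕ) :
    ‖z ^ l / (l : ℂ) ^ a‖ ≤ 1 / (l : ℝ) := by
  rw [norm_div, norm_pow, norm_pow, hz, one_pow, Complex.norm_natCast]
  rcases Nat.eq_zero_or_pos l with rfl | hl
  · simp [ha.ne']
  · have hl' : (1:ℝ) ≤ l := by exact_mod_cast hl
    gcongr
    exact le_self_pow₀ hl' ha.ne'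

lemma Cs_Bd {n : ℕ} (a : Fin (n + 1) → ℕ) (z : Fin (n + 1) → ℂ) (ha : ∀ j, 0 < a j)
    (hz : ∀ j, ‖z j‖ = 1) : Bd (Cs a z) := by
  induction n with
  | zero =>
    refine ⟨1, by norm_num, fun l hl => ?_⟩
    rw [Cs_one a z (ha 0)]
    refine (norm_w _ (hz 0) _ (ha 0) l).trans ?_
    have hl' : (1:ℝ) ≤ l := by exact_mod_cast hl
    gcongr
    rw [Real.sqrt_le_left (by positivity)]
    nlinarith
  | succ n ih =>
    have := Bd.sum_div (ih (fun i => a i.succ) (fun i => z i.succ) (fun i => ha _) (fun i => hz _))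
      (Cs_zero _ _) _ (norm_w (z 0) (hz 0) (a 0) (ha 0))
    have h : Cs a z = _ := funext (Cs_succ a z)
    rw [h]
    exact this

lemma Bd.summable {c : ℕ → ℂ} (hc : Bd c) : Summable (fun l : ℕ => ‖c l‖ / (l : ℝ)) := by
  obtain ⟨C, hC, h⟩ := hc
  have hs : Summable (fun l : ℕ => C * (1 / (l : ℝ) ^ ((3:ℝ)/2))) :=
    (Real.summable_one_div_nat_rpow.2 (by norm_num)).mul_left C
  refine Summable.of_nonneg_of_le (fun l => by positivity) (fun l => ?_) hs
  rcases Nat.eq_zero_or_pos l with rfl | hl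
  · simp
  · have hl' : (0:ℝ) < l := by exact_mod_cast hl
    have e : (l : ℝ) ^ ((3:ℝ)/2) = √l * l := by
      rw [Real.sqrt_eq_rpow, show (3:ℝ)/2 = 1/2 + 1 by norm_num, Real.rpow_add hl', Real.rpow_one]
    rw [e]
    calc _ ≤ (C / √l) / l := by gcongr; exact h l hl
      _ = _ := by field_simp

lemma Cs_update {n : ℕ} (a : Fin (n + 1) → ℕ) (z : Fin (n + 1) → ℂ) (a' : Fin (n + 1) → ℕ)
    (ha' : a' = Function.update a 0 (a 0 + 1)) (l : ℕ) : Cs a' z l = Cs a z l / l := by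
  unfold Cs
  rw [Finset.sum_div]
  refine Finset.sum_congr rfl fun f hf => ?_
  rw [mem_TT] at hf
  rw [Fin.prod_univ_succ, Fin.prod_univ_succ, ha', hf.2]
  simp only [Function.update_self, ne_eq, Fin.succ_ne_zero, not_false_eq_true,
    Function.update_of_ne]
  rw [pow_succ, ← div_div]
  ring

/-- fibre equivalence -/
def fibEquiv (n : ℕ) : (Σ l : ℕ, {f : Fin (n + 1) → ℕ // f ∈ TT n l}) ≃
    {f : Fin (n + 1) → ℕ // StrictAnti f ∧ ∀ i, 0 < f i} where
  toFun p := ⟨p.2.1, (mem_TT.1 p.2.2).1⟩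
  invFun f := ⟨f.1 0, f.1, mem_TT.2 ⟨f.2, rfl⟩⟩
  left_inv := by
    rintro ⟨l, f, hf⟩
    have := (mem_TT.1 hf).2
    subst this
    rfl
  right_inv f := rfl

lemma MPL_eq {n : ℕ} (a : Fin (n + 1) → ℕ) (z : Fin (n + 1) → ℂ) (ha : ∀ j, 0 < a j)
    (hz : ∀ j, ‖z j‖ = 1) (a' : Fin (n + 1) → ℕ) (ha' : a' = Function.update a 0 (a 0 + 1)) :
    MPL a' z = ∑' l : ℕ, Cs a z l / (l : ℂ) := by
  unfold MPL
  rw [← (fibEquiv n).tsum_eq]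
  have key : ∀ (z : Fin (n + 1) → ℂ) (l : ℕ), HasSum (fun f : {f : Fin (n + 1) → ℕ // f ∈ TT n l} =>
      ∏ j, z j ^ (f.1 j) / ((f.1 j : ℂ) ^ (a' j))) (Cs a z l / (l : ℂ)) := by
    intro z l
    rw [← Cs_update a z a' ha']
    exact (TT n l).hasSum (fun f => ∏ j, z j ^ (f j) / ((f j : ℂ) ^ (a' j)))
  have key2 : ∀ l : ℕ, HasSum (fun f : {f : Fin (n + 1) → ℕ // f ∈ TT n l} =>
      ‖∏ j, z j ^ (f.1 j) / ((f.1 j : ℂ) ^ (a' j))‖) (‖Cs a (fun _ => 1) l‖ / (l : ℝ)) := by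
    intro l
    have h1 := key (fun _ => 1) l
    have h2 : HasSum (fun f : {f : Fin (n + 1) → ℕ // f ∈ TT n l} =>
      ((‖∏ j, z j ^ (f.1 j) / ((f.1 j : ℂ) ^ (a' j))‖ : ℝ) : ℂ)) (Cs a (fun _ => 1) l / (l : ℂ)) := by
      convert h1 using 2 with f
      rw [norm_prod]
      push_cast
      refine Finset.prod_congr rfl fun j _ => ?_
      simp [hz]
    have h3 := Complex.hasSum_re h2
    simp only [Complex.ofReal_re] at h3
    have h4 : 0 ≤ (Cs a (fun _ => 1) l / (l : ℂ)).re := h3.nonneg fun f => norm_nonneg _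
    have h5 : (Cs a (fun _ => 1) l / (l : ℂ)).im = 0 := by
      rw [← (Complex.hasSum_im h2).tsum_eq]
      simp only [Complex.ofReal_im, tsum_zero]
    have h6 : ‖Cs a (fun _ => 1) l‖ / (l : ℝ) = (Cs a (fun _ => 1) l / (l : ℂ)).re := by
      rw [← Complex.norm_natCast, ← norm_div, ← Complex.re_add_im (Cs a (fun _ => 1) l / (l : ℂ)), h5]
      simp only [Complex.ofReal_zero, zero_mul, add_zero, Complex.norm_real, Real.norm_eq_abs,
        abs_of_nonneg h4, Complex.ofReal_re]
    rw [h6]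
    exact h3
  have hs : Summable (fun p : (Σ l : ℕ, {f : Fin (n + 1) → ℕ // f ∈ TT n l}) =>
      ∏ j, z j ^ (((fibEquiv n) p).1 j) / ((((fibEquiv n) p).1 j : ℂ) ^ (a' j))) := by
    refine Summable.of_norm ?_
    rw [summable_sigma_of_nonneg fun _ => norm_nonneg _]
    refine ⟨fun l => (key2 l).summable, ?_⟩
    have : Summable (fun l : ℕ => ‖Cs a (fun _ => 1) l‖ / (l : ℝ)) :=
      (Cs_Bd a (fun _ => 1) ha (fun _ => by simp)).summable
    refine this.congr fun l => ?_
    exact (key2 l).tsum_eq.symm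
  rw [hs.tsum_sigma]
  exact tsum_congr fun l => (key z l).tsum_eq

def delta0 : ℕ → ℂ := fun n => if n = 0 then 1 else 0

/-- generating coefficient sequences -/
def Gen (N k : ℕ) (c : ℕ → ℂ) : Prop :=
  (k = 0 ∧ c = delta0) ∨ ∃ (n : ℕ) (a : Fin (n + 1) → ℕ) (z : Fin (n + 1) → ℂ),
    (∀ j, 0 < a j) ∧ (∀ j, z j ^ N = 1) ∧ (∑ j, a j = k) ∧ c = Cs a z

def VV (N k : ℕ) : Submodule ℚ (ℕ → ℂ) := Submodule.span ℚ {c | Gen N k c}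

def Op0 : (ℕ → ℂ) →ₗ[ℚ] (ℕ → ℂ) where
  toFun c l := c l / l
  map_add' c d := by funext l; simp [add_div]
  map_smul' q c := by funext l; simp [Rat.smul_def, mul_div_assoc]

def OpS (s : ℂ) : (ℕ → ℂ) →ₗ[ℚ] (ℕ → ℂ) where
  toFun c l := (∑ j ∈ Finset.range l, c j * s ^ (l - j)) / l
  map_add' c d := by funext l; simp [add_mul, Finset.sum_add_distrib, add_div]
  map_smul' q c := by
    funext l
    simp [Rat.smul_def, mul_div_assoc, Finset.mul_sum, Finset.sum_div, mul_assoc]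

lemma root_norm {N : ℕ} (hN : 0 < N) {z : ℂ} (h : z ^ N = 1) : ‖z‖ = 1 :=
  Complex.norm_eq_one_of_pow_eq_one h hN.ne'

lemma Cs_twist {n : ℕ} (a : Fin (n + 1) → ℕ) (z : Fin (n + 1) → ℂ) (s : ℂ) (l : ℕ) :
    Cs a (Function.update z 0 (z 0 * s)) l = Cs a z l * s ^ l := by
  unfold Cs
  rw [Finset.sum_mul]
  refine Finset.sum_congr rfl fun f hf => ?_
  rw [mem_TT] at hf
  rw [Fin.prod_univ_succ, Fin.prod_univ_succ, hf.2]
  simp only [Function.update_self, ne_eq, Fin.succ_ne_zero, not_false_eq_true,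
    Function.update_of_ne]
  rw [mul_pow]
  ring

lemma sum_update {n : ℕ} (a : Fin (n + 1) → ℕ) :
    ∑ j, Function.update a 0 (a 0 + 1) j = ∑ j, a j + 1 := by
  rw [Fin.sum_univ_succ, Fin.sum_univ_succ]
  simp
  ring

lemma Op0_mem {N k : ℕ} {c : ℕ → ℂ} (hc : c ∈ VV N (k + 1)) : Op0 c ∈ VV N (k + 2) := by
  have : VV N (k + 1) ≤ (VV N (k + 2)).comap Op0 := by
    refine Submodule.span_le.2 ?_
    rintro c (⟨h, _⟩ | ⟨n, a, z, ha, hz, hk, rfl⟩)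
    · omega
    · refine Submodule.subset_span (Or.inr ⟨n, Function.update a 0 (a 0 + 1), z, ?_, hz, ?_, ?_⟩)
      · intro j
        by_cases hj : j = 0
        · subst hj; simp
        · simp [hj, ha]
      · rw [sum_update, hk]
      · funext l
        exact (Cs_update a z _ rfl l).symm
  exact this hc

lemma OpS_mem {N k : ℕ} (hN : 0 < N) {s : ℂ} (hs : s ^ N = 1) {c : ℕ → ℂ} (hc : c ∈ VV N k) :
    OpS s c ∈ VV N (k + 1) := by
  have hs0 : s ≠ 0 := by
    rintro rfl
    simp [hN.ne'] at hs
  have : VV N k ≤ (VV N (k + 1)).comap (OpS s) := by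
    refine Submodule.span_le.2 ?_
    rintro c (⟨h, rfl⟩ | ⟨n, a, z, ha, hz, hk, rfl⟩)
    · refine Submodule.subset_span (Or.inr ⟨0, fun _ => 1, fun _ => s, fun _ => one_pos,
        fun _ => hs, by simp [h], ?_⟩)
      funext l
      rw [Cs_one _ _ one_pos]
      rcases Nat.eq_zero_or_pos l with rfl | hl
      · simp [OpS]
      · simp [OpS, delta0, hl]
    · refine Submodule.subset_span (Or.inr ⟨n + 1, Fin.cons 1 a,
        Fin.cons s (Function.update z 0 (z 0 * s⁻¹)), ?_, ?_, ?_, ?_⟩)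
      · intro j
        refine Fin.cases ?_ (fun i => ?_) j
        · simp
        · simpa using ha i
      · intro j
        refine Fin.cases ?_ (fun i => ?_) j
        · simpa using hs
        · simp only [Fin.cons_succ]
          by_cases hi : i = 0
          · subst hi
            simp [mul_pow, hz, hs]
          · simp [hi, hz]
      · rw [Fin.sum_univ_succ]
        simp [hk, add_comm]
      · funext l
        rw [Cs_succ]
        simp only [Fin.cons_zero, Fin.cons_succ, pow_one]
        simp only [OpS, LinearMap.coe_mk, AddHom.coe_mk]
        rw [div_mul_eq_mul_div, Finset.mul_sum]
        congr 1
        refine Finset.sum_congr rfl fun j hj => ?_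
        rw [Cs_twist, inv_pow, pow_sub₀ s hs0 (Finset.mem_range.1 hj).le]
        ring
  exact this hc

lemma VV_Bd {N k : ℕ} (hN : 0 < N) {c : ℕ → ℂ} (hc : c ∈ VV N k) : Bd c := by
  refine Submodule.span_induction (p := fun c _ => Bd c) ?_ ?_ ?_ ?_ hc
  · rintro c (⟨h, rfl⟩ | ⟨n, a, z, ha, hz, hk, rfl⟩)
    · refine ⟨0, le_rfl, fun l hl => ?_⟩
      simp [delta0, hl.ne']
    · exact Cs_Bd a z ha fun j => root_norm hN (hz j)
  · exact ⟨0, le_rfl, fun l hl => by simp⟩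
  · rintro c d _ _ ⟨C, hC, h1⟩ ⟨D, hD, h2⟩
    refine ⟨C + D, by positivity, fun l hl => ?_⟩
    rw [add_div]
    exact (norm_add_le _ _).trans (add_le_add (h1 l hl) (h2 l hl))
  · rintro q c _ ⟨C, hC, h1⟩
    refine ⟨‖(q:ℂ)‖ * C, by positivity, fun l hl => ?_⟩
    rw [Pi.smul_apply, Rat.smul_def, norm_mul, mul_div_assoc]
    exact mul_le_mul_of_nonneg_left (h1 l hl) (norm_nonneg _)

lemma VV_zero {N k : ℕ} {c : ℕ → ℂ} (hc : c ∈ VV N (k + 1)) : c 0 = 0 := by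
  refine Submodule.span_induction (p := fun c _ => c 0 = 0) ?_ ?_ ?_ ?_ hc
  · rintro c (⟨h, rfl⟩ | ⟨n, a, z, ha, hz, hk, rfl⟩)
    · omega
    · exact Cs_zero a z
  · rfl
  · intro c d _ _ h1 h2
    simp [h1, h2]
  · intro q c _ h1
    simp [h1]

lemma VV_tsum {N k : ℕ} (hN : 0 < N) {c : ℕ → ℂ} (hc : c ∈ VV N (k + 1)) :
    ∑' l : ℕ, c l / (l : ℂ) ∈ zspan (k + 2) N := by
  have hsum : ∀ c ∈ VV N (k + 1), Summable (fun l : ℕ => c l / (l : ℂ)) := by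
    intro c hc
    refine Summable.of_norm ?_
    simpa using (VV_Bd hN hc).summable
  refine Submodule.span_induction (p := fun c _ => ∑' l : ℕ, c l / (l : ℂ) ∈ zspan (k + 2) N)
    ?_ ?_ ?_ ?_ hc
  · rintro c (⟨h, rfl⟩ | ⟨n, a, z, ha, hz, hk, rfl⟩)
    · omega
    · refine Submodule.subset_span ⟨n, Function.update a 0 (a 0 + 1), z, ?_, hz, ?_, ?_, ?_⟩
      · intro j
        by_cases hj : j = 0
        · subst hj; simp
        · simp [hj, ha]
      · rw [sum_update, hk]
      · rintro ⟨h, _⟩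
        have := ha 0
        simp at h
        omega
      · exact (MPL_eq a z ha (fun j => root_norm hN (hz j)) _ rfl).symm
  · simp
  · intro c d hc hd h1 h2
    simp only [Pi.add_apply, add_div]
    rw [(hsum c hc).tsum_add (hsum d hd)]
    exact Submodule.add_mem _ h1 h2
  · intro q c hc h1
    simp only [Pi.smul_apply, Rat.smul_def, mul_div_assoc]
    rw [tsum_mul_left, ← Rat.smul_def]
    exact Submodule.smul_mem _ _ h1


/-! ### Power series on `(0,1)` -/

def PB (A : ℕ → ℂ) : Prop := ∃ (C : ℝ) (d : ℕ), 0 ≤ C ∧ ∀ n : ℕ, ‖A n‖ ≤ C * ((n : ℝ) + 1) ^ d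

def ev (A : ℕ → ℂ) (x : ℝ) : ℂ := ∑' n : ℕ, A n * (x : ℂ) ^ n

lemma summable_aux (d : ℕ) {r : ℝ} (h0 : 0 < r) (h1 : r < 1) :
    Summable (fun n : ℕ => ((n : ℝ) + 1) ^ d * r ^ n) := by
  have h : Summable (fun n : ℕ => ((n : ℝ)) ^ d * r ^ n) :=
    summable_pow_mul_geometric_of_norm_lt_one d (by rwa [Real.norm_of_nonneg h0.le])
  have h2 := ((summable_nat_add_iff 1).2 h).mul_right r⁻¹
  refine h2.congr fun n => ?_
  push_cast
  field_simp
  ring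

lemma PB.summable_norm {A : ℕ → ℂ} (hA : PB A) {r : ℝ} (h0 : 0 ≤ r) (h1 : r < 1) :
    Summable (fun n : ℕ => ‖A n‖ * r ^ n) := by
  obtain ⟨C, d, hC, h⟩ := hA
  obtain ⟨q, hq0, hq1⟩ := exists_between (show r < 1 from h1)
  have hq : 0 < q := lt_of_le_of_lt h0 hq0
  refine Summable.of_nonneg_of_le (fun n => by positivity) (fun n => ?_)
    ((summable_aux d hq hq1).mul_left C)
  calc ‖A n‖ * r ^ n ≤ (C * ((n : ℝ) + 1) ^ d) * q ^ n := by
        gcongr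
        exact h n
    _ = _ := by ring

lemma PB.summable {A : ℕ → ℂ} (hA : PB A) {x : ℝ} (h0 : 0 ≤ x) (h1 : x < 1) :
    Summable (fun n : ℕ => A n * (x : ℂ) ^ n) := by
  refine Summable.of_norm ((hA.summable_norm h0 h1).congr fun n => ?_)
  rw [norm_mul, norm_pow, Complex.norm_real, Real.norm_of_nonneg h0]

lemma PB.add {A B : ℕ → ℂ} (hA : PB A) (hB : PB B) : PB (fun n => A n + B n) := by
  obtain ⟨C, d, hC, h⟩ := hA
  obtain ⟨D, e, hD, h'⟩ := hB
  refine ⟨C + D, d + e, by positivity, fun n => (norm_add_le _ _).trans ?_⟩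
  have h1 : (1:ℝ) ≤ (n:ℝ) + 1 := by linarith [(Nat.cast_nonneg n : (0:ℝ) ≤ n)]
  have e1 := pow_le_pow_right₀ h1 (Nat.le_add_right d e)
  have e2 := pow_le_pow_right₀ h1 (Nat.le_add_left e d)
  rw [add_mul]
  exact add_le_add ((h n).trans (by gcongr)) ((h' n).trans (by gcongr))

lemma PB.mul {A B : ℕ → ℂ} (hA : PB A) (hB : PB B) : PB (fun n => A n * B n) := by
  obtain ⟨C, d, hC, h⟩ := hA
  obtain ⟨D, e, hD, h'⟩ := hB
  refine ⟨C * D, d + e, by positivity, fun n => ?_⟩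
  rw [norm_mul, pow_add]
  calc _ ≤ (C * ((n : ℝ) + 1) ^ d) * (D * ((n : ℝ) + 1) ^ e) :=
        mul_le_mul (h n) (h' n) (norm_nonneg _) (by positivity)
    _ = _ := by ring

lemma PB.natCast : PB (fun n => (n : ℂ)) :=
  ⟨1, 1, zero_le_one, fun n => by simp⟩

lemma PB.const (a : ℂ) : PB (fun _ => a) :=
  ⟨‖a‖, 0, norm_nonneg _, fun n => by simp⟩

lemma PB.div {A : ℕ → ℂ} (hA : PB A) : PB (fun n => A n / (n : ℂ)) := by
  obtain ⟨C, d, hC, h⟩ := hA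
  refine ⟨C, d, hC, fun n => le_trans ?_ (h n)⟩
  rw [norm_div, Complex.norm_natCast]
  rcases Nat.eq_zero_or_pos n with rfl | hn
  · simp
  · have hn' : (1:ℝ) ≤ n := by exact_mod_cast hn
    exact div_le_self (norm_nonneg _) hn'

lemma PB.shift {A : ℕ → ℂ} (hA : PB A) : PB (fun n => A (n + 1)) := by
  obtain ⟨C, d, hC, h⟩ := hA
  refine ⟨C * 2 ^ d, d, by positivity, fun n => (h _).trans ?_⟩
  rw [mul_assoc, ← mul_pow]
  gcongr
  push_cast
  linarith [(Nat.cast_nonneg n : (0:ℝ) ≤ n)]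

lemma PB.sumS {A : ℕ → ℂ} (hA : PB A) (s : ℂ) (hs : ‖s‖ = 1) :
    PB (fun n => ∑ j ∈ Finset.range n, A j * s ^ (n - j)) := by
  obtain ⟨C, d, hC, h⟩ := hA
  refine ⟨C, d + 1, hC, fun n => (norm_sum_le _ _).trans ?_⟩
  calc _ ≤ ∑ j ∈ Finset.range n, C * ((n : ℝ) + 1) ^ d := by
        refine Finset.sum_le_sum fun j hj => ?_
        rw [norm_mul, norm_pow, hs, one_pow, mul_one]
        have : (j : ℝ) ≤ n := by exact_mod_cast (Finset.mem_range.1 hj).le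
        exact (h j).trans (by gcongr)
    _ ≤ _ := by
        rw [Finset.sum_const, Finset.card_range, nsmul_eq_mul, pow_succ]
        have : 0 ≤ C * ((n : ℝ) + 1) ^ d := by positivity
        nlinarith

lemma PB.sum {A : ℕ → ℂ} (hA : PB A) : PB (fun n => ∑ j ∈ Finset.range n, A j) := by
  simpa using hA.sumS 1 (by simp)

lemma Bd.PB {c : ℕ → ℂ} (hc : Bd c) : PB c := by
  obtain ⟨C, hC, h⟩ := hc
  refine ⟨C + ‖c 0‖, 0, by positivity, fun n => ?_⟩
  rw [pow_zero, mul_one]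
  rcases Nat.eq_zero_or_pos n with rfl | hn
  · linarith
  · refine (h n hn).trans ?_
    have hn' : (1:ℝ) ≤ √n := by rw [Real.one_le_sqrt]; exact_mod_cast hn
    have := div_le_self hC hn'
    linarith [norm_nonneg (c 0)]

lemma ev_hasDerivAt_aux {A : ℕ → ℂ} (hA : PB A) {x : ℝ} (hx : |x| < 1) :
    HasDerivAt (ev A) (∑' n : ℕ, A n * ((n : ℂ) * (x : ℂ) ^ (n - 1))) x := by
  obtain ⟨ρ, h1, h2⟩ := exists_between hx
  have hρ : 0 < ρ := lt_of_le_of_lt (abs_nonneg x) h1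
  have hu : Summable (fun n : ℕ => ‖A n‖ * (n * ρ ^ (n - 1))) := by
    have := ((hA.mul PB.natCast).summable_norm hρ.le h2).mul_right ρ⁻¹
    refine this.congr fun n => ?_
    rcases n with _ | n
    · simp
    · rw [norm_mul, Complex.norm_natCast, pow_succ, Nat.add_sub_cancel]
      field_simp
  have := hasDerivAt_tsum_of_isPreconnected (𝕜 := ℝ) (t := Metric.ball (0:ℝ) ρ) (y₀ := 0) (y := x)
    (g := fun (n : ℕ) (y : ℝ) => A n * (y : ℂ) ^ n)
    (g' := fun (n : ℕ) (y : ℝ) => A n * ((n : ℂ) * (y : ℂ) ^ (n - 1))) hu Metric.isOpen_ball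
    (convex_ball _ _).isPreconnected ?_ ?_ ?_ ?_ ?_
  · exact this
  · intro n y hy
    have h := (hasDerivAt_pow n (y : ℂ)).comp_ofReal
    exact h.const_mul (A n)
  · intro n y hy
    rw [Metric.mem_ball, dist_zero_right] at hy
    rw [norm_mul, norm_mul, norm_pow, Complex.norm_real, Complex.norm_natCast]
    gcongr
  · simpa using hρ
  · exact hA.summable le_rfl one_pos
  · simpa using h1

lemma ev_zero (A : ℕ → ℂ) : ev A 0 = A 0 := by
  unfold ev
  rw [tsum_eq_single 0]
  · simp
  · intro n hn
    simp [hn]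

lemma ev_tendsto {A : ℕ → ℂ} (hA : PB A) : Filter.Tendsto (ev A) (nhds 0) (nhds (A 0)) := by
  rw [← ev_zero A]
  exact (ev_hasDerivAt_aux hA (x := 0) (by simp)).continuousAt.tendsto

lemma ev_hasDerivAt {A : ℕ → ℂ} (hA : PB A) {x : ℝ} (h0 : 0 < x) (h1 : x < 1) :
    HasDerivAt (ev A) (ev (fun n => n * A n) x / x) x := by
  convert ev_hasDerivAt_aux hA (x := x) (by rwa [abs_of_pos h0]) using 1
  unfold ev
  rw [← tsum_div_const]
  refine tsum_congr fun n => ?_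
  have : (x : ℂ) ≠ 0 := by exact_mod_cast h0.ne'
  rcases n with _ | n
  · simp
  · rw [pow_succ, Nat.add_sub_cancel]
    field_simp

lemma ev_add {A B : ℕ → ℂ} (hA : PB A) (hB : PB B) {x : ℝ} (h0 : 0 ≤ x) (h1 : x < 1) :
    ev (fun n => A n + B n) x = ev A x + ev B x := by
  unfold ev
  rw [← (hA.summable h0 h1).tsum_add (hB.summable h0 h1)]
  exact tsum_congr fun n => by ring

lemma ev_smul (a : ℂ) (A : ℕ → ℂ) (x : ℝ) :
    ev (fun n => a * A n) x = a * ev A x := by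
  unfold ev
  rw [← tsum_mul_left]
  exact tsum_congr fun n => by ring

/-- if `A 0 = 0` and `A (n+1) = B n` then `ev A = x ev B`. -/
lemma ev_shift {A B : ℕ → ℂ} (hA : PB A) (h00 : A 0 = 0) (h : ∀ n, A (n + 1) = B n)
    {x : ℝ} (h0 : 0 ≤ x) (h1 : x < 1) : ev A x = x * ev B x := by
  unfold ev
  rw [(hA.summable h0 h1).tsum_eq_zero_add, h00, zero_mul, zero_add, ← tsum_mul_left]
  exact tsum_congr fun n => by rw [h, pow_succ]; ring

lemma one_sub_ne {s : ℂ} (hs : ‖s‖ = 1) {x : ℝ} (h0 : 0 < x) (h1 : x < 1) :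
    (1 : ℂ) - s * x ≠ 0 := by
  intro h
  have h2 : s * x = 1 := (sub_eq_zero.1 h).symm
  have := congrArg norm h2
  rw [norm_mul, hs, one_mul, Complex.norm_real, Real.norm_of_nonneg h0.le, norm_one] at this
  linarith

lemma ev_sumS {A : ℕ → ℂ} (hA : PB A) {s : ℂ} (hs : ‖s‖ = 1) {x : ℝ} (h0 : 0 < x) (h1 : x < 1) :
    ev (fun n => ∑ j ∈ Finset.range n, A j * s ^ (n - j)) x = s * x / (1 - s * x) * ev A x := by
  have hE := hA.sumS s hs
  have h := ev_shift (B := fun n => s * ((∑ j ∈ Finset.range n, A j * s ^ (n - j)) + A n)) hE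
    (by simp) (fun n => ?_) h0.le h1
  · rw [ev_smul, ev_add hE hA h0.le h1] at h
    have := one_sub_ne hs h0 h1
    field_simp
    linear_combination h
  · rw [Finset.sum_range_succ, mul_add, Finset.mul_sum]
    congr 1
    · refine Finset.sum_congr rfl fun j hj => ?_
      rw [Nat.succ_sub (Finset.mem_range.1 hj).le, pow_succ]
      ring
    · rw [Nat.add_sub_cancel_left, pow_one, mul_comm]

lemma Op0_deriv {c : ℕ → ℂ} (hc : PB c) (hc0 : c 0 = 0) {x : ℝ} (h0 : 0 < x) (h1 : x < 1) :
    HasDerivAt (ev (Op0 c)) (ev c x / x) x := by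
  have := ev_hasDerivAt (A := Op0 c) hc.div h0 h1
  convert this using 3
  funext n
  rcases n with _ | n
  · simp [hc0]
  · have : ((n + 1 : ℕ) : ℂ) ≠ 0 := by exact_mod_cast n.succ_ne_zero
    simp only [Op0, LinearMap.coe_mk, AddHom.coe_mk]
    field_simp

lemma OpS_deriv {c : ℕ → ℂ} (hc : PB c) {s : ℂ} (hs : ‖s‖ = 1) {x : ℝ} (h0 : 0 < x) (h1 : x < 1) :
    HasDerivAt (ev (OpS s c)) (s / (1 - s * x) * ev c x) x := by
  have := ev_hasDerivAt (A := OpS s c) (hc.sumS s hs).div h0 h1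
  convert this using 1
  have e : (fun n : ℕ => (n : ℂ) * OpS s c n) =
      (fun n => ∑ j ∈ Finset.range n, c j * s ^ (n - j)) := by
    funext n
    rcases n with _ | n
    · simp
    · have : ((n + 1 : ℕ) : ℂ) ≠ 0 := by exact_mod_cast n.succ_ne_zero
      simp only [OpS, LinearMap.coe_mk, AddHom.coe_mk]
      field_simp
  rw [e, ev_sumS hc hs h0 h1]
  have hx : (x : ℂ) ≠ 0 := by exact_mod_cast h0.ne'
  field_simp

lemma uniq {F G : ℝ → ℂ} {f : ℝ → ℂ} (hF : ∀ x, 0 < x → x < 1 → HasDerivAt F (f x) x)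
    (hG : ∀ x, 0 < x → x < 1 → HasDerivAt G (f x) x)
    (hF0 : Filter.Tendsto F (nhdsWithin 0 (Set.Ioi 0)) (nhds 0))
    (hG0 : Filter.Tendsto G (nhdsWithin 0 (Set.Ioi 0)) (nhds 0)) :
    ∀ x, 0 < x → x < 1 → F x = G x := by
  have hd : ∀ x ∈ Set.Ioo (0:ℝ) 1, HasDerivAt (fun x => F x - G x) 0 x := by
    intro x hx
    have h := (hF x hx.1 hx.2).sub (hG x hx.1 hx.2)
    rw [sub_self] at h
    exact h
  intro x h0 h1
  have hc : ∀ y ∈ Set.Ioo (0:ℝ) 1, F y - G y = F x - G x := by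
    intro y hy
    refine (convex_Ioo (0:ℝ) 1).is_const_of_fderivWithin_eq_zero (𝕜 := ℝ) (f := fun x => F x - G x)
      (fun z hz => (hd z hz).differentiableAt.differentiableWithinAt) (fun z hz => ?_) hy ⟨h0, h1⟩
    have := (hd z hz).hasDerivWithinAt (s := Set.Ioo (0:ℝ) 1)
    rw [hasDerivWithinAt_iff_hasFDerivWithinAt] at this
    rw [this.fderivWithin (isOpen_Ioo.uniqueDiffWithinAt hz)]
    ext; simp
  have hl : Filter.Tendsto (fun x => F x - G x) (nhdsWithin 0 (Set.Ioi 0)) (nhds (F x - G x)) := by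
    refine tendsto_const_nhds.congr' ?_
    filter_upwards [Ioo_mem_nhdsGT (show (0:ℝ) < 1 by norm_num)] with y hy
    exact (hc y hy).symm
  have := tendsto_nhds_unique hl (hF0.sub hG0)
  simpa [sub_eq_zero] using this


/-! ### Changes of variable -/

def zz (p : ℕ) (x : ℝ) : ℝ := 4 * x ^ p / (1 + x ^ p) ^ 2
def kk (p : ℕ) (x : ℝ) : ℝ := (1 - x ^ p) / (1 + x ^ p)

lemma zz_pos (p : ℕ) {x : ℝ} (h0 : 0 < x) : 0 < zz p x := by unfold zz; positivity

lemma zz_lt (p : ℕ) (hp : p ≠ 0) {x : ℝ} (h0 : 0 < x) (h1 : x < 1) : zz p x < 1 := by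
  unfold zz
  have h2 : x ^ p < 1 := pow_lt_one₀ h0.le h1 hp
  have h3 : 0 < x ^ p := by positivity
  rw [div_lt_one (by positivity)]
  nlinarith [mul_pos (sub_pos.2 h2) (sub_pos.2 h2)]

lemma pow_deriv' (p : ℕ) (hp : p ≠ 0) {x : ℝ} (h0 : 0 < x) :
    HasDerivAt (fun x : ℝ => x ^ p) (p * x ^ p / x) x := by
  refine (hasDerivAt_pow p x).congr_deriv ?_
  obtain ⟨q, rfl⟩ := Nat.exists_eq_succ_of_ne_zero hp
  rw [Nat.succ_eq_add_one, pow_succ, Nat.add_sub_cancel]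
  field_simp

lemma zz_deriv (p : ℕ) (hp : p ≠ 0) {x : ℝ} (h0 : 0 < x) :
    HasDerivAt (zz p) (p * kk p x * zz p x / x) x := by
  have h := pow_deriv' p hp h0
  have h3 : 0 < x ^ p := by positivity
  have h2 := (h.const_mul 4).div ((h.const_add 1).pow 2)
    (by have : (0:ℝ) < (1 + x ^ p) ^ 2 := by positivity
        exact this.ne')
  refine h2.congr_deriv ?_
  unfold kk zz
  have : 1 + x ^ p ≠ 0 := by positivity
  simp only [Pi.pow_apply]
  field_simp
  ring

lemma zz_tendsto (p : ℕ) (hp : p ≠ 0) : Filter.Tendsto (zz p) (nhds 0) (nhds 0) := by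
  have : ContinuousAt (zz p) 0 := by
    unfold zz
    refine ContinuousAt.div (by fun_prop) (by fun_prop) ?_
    simp [hp]
  have h := this.tendsto
  have e : zz p 0 = 0 := by simp [zz, hp]
  rwa [e] at h

lemma evz_tendsto (p : ℕ) (hp : p ≠ 0) {A : ℕ → ℂ} (hA : PB A) :
    Filter.Tendsto (fun x => ev A (zz p x)) (nhdsWithin 0 (Set.Ioi 0)) (nhds (A 0)) :=
  ((ev_tendsto hA).comp (zz_tendsto p hp)).mono_left nhdsWithin_le_nhds

lemma evz_deriv (p : ℕ) (hp : p ≠ 0) {A : ℕ → ℂ} (hA : PB A) {x : ℝ} (h0 : 0 < x) (h1 : x < 1) :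
    HasDerivAt (fun x => ev A (zz p x)) (p * kk p x / x * ev (fun n => n * A n) (zz p x)) x := by
  have h := (ev_hasDerivAt hA (zz_pos p h0) (zz_lt p hp h0 h1)).scomp x (zz_deriv p hp h0)
  refine h.congr_deriv ?_
  have : ((zz p x : ℝ) : ℂ) ≠ 0 := by exact_mod_cast (zz_pos p h0).ne'
  rw [Complex.real_smul]
  push_cast
  field_simp

/-! ### Function classes -/

def Wp (N k : ℕ) (F : ℝ → ℂ) : Prop :=
  ∃ c ∈ VV N k, ∀ x, 0 < x → x < 1 → F x = ev c x

def IW (N k : ℕ) (g : ℝ → ℂ) : Prop :=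
  ∃ G, Wp N k G ∧ Filter.Tendsto G (nhdsWithin 0 (Set.Ioi 0)) (nhds 0) ∧
    ∀ x, 0 < x → x < 1 → HasDerivAt G (g x) x

lemma Wp.congr {N k : ℕ} {F G : ℝ → ℂ} (hF : Wp N k F) (h : ∀ x, 0 < x → x < 1 → G x = F x) :
    Wp N k G := by
  obtain ⟨c, hc, h'⟩ := hF
  exact ⟨c, hc, fun x h0 h1 => (h x h0 h1).trans (h' x h0 h1)⟩

lemma Wp.add {N k : ℕ} (hN : 0 < N) {F G : ℝ → ℂ} (hF : Wp N k F) (hG : Wp N k G) :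
    Wp N k (fun x => F x + G x) := by
  obtain ⟨c, hc, h⟩ := hF
  obtain ⟨d, hd, h'⟩ := hG
  refine ⟨c + d, Submodule.add_mem _ hc hd, fun x h0 h1 => ?_⟩
  beta_reduce
  rw [h x h0 h1, h' x h0 h1]
  exact (ev_add (VV_Bd hN hc).PB (VV_Bd hN hd).PB h0.le h1).symm

lemma Wp.smul {N k : ℕ} (q : ℚ) {F : ℝ → ℂ} (hF : Wp N k F) :
    Wp N k (fun x => (q : ℂ) * F x) := by
  obtain ⟨c, hc, h⟩ := hF
  refine ⟨q • c, Submodule.smul_mem _ _ hc, fun x h0 h1 => ?_⟩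
  beta_reduce
  rw [h x h0 h1, ← ev_smul]
  congr 1

lemma IW.congr {N k : ℕ} {f g : ℝ → ℂ} (hf : IW N k f) (h : ∀ x, 0 < x → x < 1 → g x = f x) :
    IW N k g := by
  obtain ⟨G, h1, h2, h3⟩ := hf
  exact ⟨G, h1, h2, fun x h0 h1 => (h3 x h0 h1).congr_deriv (h x h0 h1).symm⟩

lemma IW.add {N k : ℕ} (hN : 0 < N) {f g : ℝ → ℂ} (hf : IW N k f) (hg : IW N k g) :
    IW N k (fun x => f x + g x) := by
  obtain ⟨F, h1, h2, h3⟩ := hf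
  obtain ⟨G, h1', h2', h3'⟩ := hg
  exact ⟨_, h1.add hN h1', by simpa using h2.add h2', fun x h0 h1 => (h3 x h0 h1).add (h3' x h0 h1)⟩

lemma IW.smul {N k : ℕ} (q : ℚ) {f : ℝ → ℂ} (hf : IW N k f) :
    IW N k (fun x => (q : ℂ) * f x) := by
  obtain ⟨F, h1, h2, h3⟩ := hf
  exact ⟨_, h1.smul q, by simpa using h2.const_mul (q : ℂ),
    fun x h0 h1 => (h3 x h0 h1).const_mul _⟩

lemma IW.eq {N k : ℕ} {g : ℝ → ℂ} (hg : IW N k g) {F : ℝ → ℂ}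
    (hF : ∀ x, 0 < x → x < 1 → HasDerivAt F (g x) x)
    (hF0 : Filter.Tendsto F (nhdsWithin 0 (Set.Ioi 0)) (nhds 0)) : Wp N k F := by
  obtain ⟨G, h1, h2, h3⟩ := hg
  exact h1.congr (uniq hF h3 hF0 h2)

lemma IW_S {N k : ℕ} (hN : 0 < N) {s : ℂ} (hs : s ^ N = 1) {F : ℝ → ℂ} (hF : Wp N k F) :
    IW N (k + 1) (fun x => s / (1 - s * x) * F x) := by
  obtain ⟨c, hc, h⟩ := hF
  have hm := OpS_mem hN hs hc
  refine ⟨ev (OpS s c), ⟨_, hm, fun x _ _ => rfl⟩, ?_, fun x h0 h1 => ?_⟩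
  · have := ev_tendsto (VV_Bd hN hm).PB
    rw [VV_zero hm] at this
    exact this.mono_left nhdsWithin_le_nhds
  · beta_reduce
    rw [h x h0 h1]
    exact OpS_deriv (VV_Bd hN hc).PB (root_norm hN hs) h0 h1

lemma IW_0 {N k : ℕ} (hN : 0 < N) {F : ℝ → ℂ} (hF : Wp N (k + 1) F) :
    IW N (k + 2) (fun x => F x / x) := by
  obtain ⟨c, hc, h⟩ := hF
  have hm := Op0_mem hc
  refine ⟨ev (Op0 c), ⟨_, hm, fun x _ _ => rfl⟩, ?_, fun x h0 h1 => ?_⟩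
  · have := ev_tendsto (VV_Bd hN hm).PB
    rw [VV_zero hm] at this
    exact this.mono_left nhdsWithin_le_nhds
  · beta_reduce
    rw [h x h0 h1]
    exact Op0_deriv (VV_Bd hN hc).PB (VV_zero hc) h0 h1

/-! ### Sequences -/

inductive Ch : ℕ → (ℕ → ℂ) → Prop
  | base : Ch 0 delta0
  | sig {k B} : Ch k B → Ch (k + 1) (fun n => (∑ m ∈ Finset.range n, B m) / (n : ℂ))
  | div {k B} : Ch (k + 1) B → Ch (k + 2) (fun n => B n / (n : ℂ))

lemma PB_delta0 : PB delta0 :=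
  ⟨1, 0, zero_le_one, fun n => by unfold delta0; split_ifs <;> simp⟩

lemma Ch.PB {k : ℕ} {B : ℕ → ℂ} (h : Ch k B) : PB B := by
  induction h with
  | base => exact PB_delta0
  | sig _ ih => exact ih.sum.div
  | div _ ih => exact ih.div

lemma Ch.zero {k : ℕ} {B : ℕ → ℂ} (h : Ch (k + 1) B) : B 0 = 0 := by
  cases h <;> simp

lemma mul_div_nat {B : ℕ → ℂ} (h : B 0 = 0) : (fun n : ℕ => (n : ℂ) * (B n / n)) = B := by
  funext n
  rcases n with _ | n
  · simp [h]
  · have : ((n + 1 : ℕ) : ℂ) ≠ 0 := by exact_mod_cast n.succ_ne_zero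
    field_simp

lemma ev_sum {A : ℕ → ℂ} (hA : PB A) {x : ℝ} (h0 : 0 < x) (h1 : x < 1) :
    ev (fun n => ∑ j ∈ Finset.range n, A j) x = x / (1 - x) * ev A x := by
  simpa using ev_sumS hA (s := 1) (by simp) h0 h1

lemma ev_delta0 (x : ℝ) : ev delta0 x = 1 := by
  unfold ev
  rw [tsum_eq_single 0]
  · simp [delta0]
  · intro n hn
    simp [hn, delta0]

lemma Wp_one (N : ℕ) : Wp N 0 (fun _ => 1) :=
  ⟨delta0, Submodule.subset_span (Or.inl ⟨rfl, rfl⟩), fun x _ _ => (ev_delta0 x).symm⟩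

lemma cne {x : ℝ} (h0 : 0 < x) (h1 : x < 1) :
    (x : ℂ) ≠ 0 ∧ (1 : ℂ) - x ≠ 0 ∧ (1 : ℂ) + x ≠ 0 ∧ (1 : ℂ) + x ^ 2 ≠ 0 ∧ (1 : ℂ) - x ^ 2 ≠ 0
     ∧ (1 : ℂ) - Complex.I * x ≠ 0 ∧ (1 : ℂ) + Complex.I * x ≠ 0 := by
  refine ⟨by exact_mod_cast h0.ne', ?_, ?_, ?_, ?_, ?_, ?_⟩
  · have : (1 - x : ℝ) ≠ 0 := by linarith
    exact_mod_cast this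
  · have : (1 + x : ℝ) ≠ 0 := by linarith
    exact_mod_cast this
  · have : (1 + x ^ 2 : ℝ) ≠ 0 := by positivity
    exact_mod_cast this
  · have : (1 - x ^ 2 : ℝ) ≠ 0 := by nlinarith
    exact_mod_cast this
  · exact one_sub_ne (by simp) h0 h1
  · have := one_sub_ne (s := -Complex.I) (by simp) h0 h1
    simpa using this

theorem thm1 {k : ℕ} {B : ℕ → ℂ} (h : Ch k B) : Wp 2 k (fun x => ev B (zz 1 x)) := by
  induction h with
  | base => exact (Wp_one 2).congr fun x _ _ => ev_delta0 _
  | @sig k B hB ih =>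
    have hP := hB.PB
    have h1 := (IW_S (N := 2) two_pos (s := 1) (by simp) ih).smul 2
    have h2 := (IW_S (N := 2) two_pos (s := -1) (by simp) ih).smul (-2)
    refine (h1.add two_pos h2).eq (fun x h0 h1 => ?_) ?_
    · refine (evz_deriv 1 one_ne_zero hP.sum.div h0 h1).congr_deriv ?_
      rw [mul_div_nat (by simp), ev_sum hP (zz_pos 1 h0) (zz_lt 1 one_ne_zero h0 h1)]
      obtain ⟨c1, c2, c3, c4, c5, -⟩ := cne h0 h1
      have : ((1 - zz 1 x : ℝ) : ℂ) = ((1 - x) / (1 + x)) ^ 2 := by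
        unfold zz
        push_cast
        field_simp
        ring
      rw [show (1 : ℂ) - (zz 1 x : ℂ) = ((1 - zz 1 x : ℝ) : ℂ) by push_cast; rfl, this]
      have e : ((zz 1 x : ℝ) : ℂ) = 4 * x / (1 + x) ^ 2 := by
        unfold zz; push_cast; ring
      rw [show (zz 1 x : ℂ) / (((1 - x) / (1 + x)) ^ 2) = (4 * x / (1 + x) ^ 2) / (((1 - x) / (1 + x)) ^ 2) by rw [e]]
      unfold kk
      push_cast
      have e1 : (1 : ℂ) - 1 * x = 1 - x := by ring
      have e2 : (1 : ℂ) - -1 * x = 1 + x := by ring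
      rw [e1, e2, pow_one]
      generalize ev B (zz 1 x) = E
      field_simp
      ring
    · simpa using evz_tendsto 1 one_ne_zero (hP.sum.div)
  | @div k B hB ih =>
    have hP := hB.PB
    have h1 := (IW_0 (N := 2) two_pos ih)
    have h2 := (IW_S (N := 2) two_pos (s := -1) (by simp) ih).smul 2
    refine (h1.add two_pos h2).eq (fun x h0 h1 => ?_) ?_
    · refine (evz_deriv 1 one_ne_zero hP.div h0 h1).congr_deriv ?_
      rw [mul_div_nat hB.zero]
      obtain ⟨c1, c2, c3, c4, c5, -⟩ := cne h0 h1
      unfold kk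
      push_cast
      have e2 : (1 : ℂ) - -1 * x = 1 + x := by ring
      rw [e2, pow_one]
      generalize ev B (zz 1 x) = E
      field_simp
      ring
    · simpa [hB.zero] using evz_tendsto 1 one_ne_zero (hP.div)


/-! ### The quadratic case -/

def ab (n : ℕ) : ℂ := 4 ^ n / (Nat.centralBinom n : ℂ)

lemma ab_succ (n : ℕ) : (2 * (n : ℂ) + 1) * ab (n + 1) = 2 * ((n : ℂ) + 1) * ab n := by
  have h := Nat.succ_mul_centralBinom_succ n
  have h' : ((n : ℂ) + 1) * (Nat.centralBinom (n + 1) : ℂ) = 2 * (2 * n + 1) * Nat.centralBinom n := by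
    exact_mod_cast h
  have c1 : (Nat.centralBinom (n + 1) : ℂ) ≠ 0 := by exact_mod_cast Nat.centralBinom_ne_zero _
  have c2 : (Nat.centralBinom n : ℂ) ≠ 0 := by exact_mod_cast Nat.centralBinom_ne_zero _
  unfold ab
  rw [pow_succ]
  field_simp
  linear_combination (-2 : ℂ) * h'

lemma PB_ab : PB ab := by
  refine ⟨2, 1, by norm_num, fun n => ?_⟩
  unfold ab
  rw [norm_div, norm_pow, Complex.norm_natCast]
  have hp : (0:ℝ) < Nat.centralBinom n := by exact_mod_cast Nat.centralBinom_pos n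
  rw [div_le_iff₀ hp]
  rcases Nat.eq_zero_or_pos n with rfl | hn
  · simp
  · have h : ((4 : ℝ)) ^ n ≤ 2 * n * Nat.centralBinom n := by
      exact_mod_cast Nat.four_pow_le_two_mul_self_mul_centralBinom n hn
    simp only [Complex.norm_ofNat, pow_one]
    nlinarith

/-- the key differential relation -/
lemma key_rel {B : ℕ → ℂ} (hB : PB B) {z : ℝ} (h0 : 0 < z) (h1 : z < 1) :
    (1 - z) * ev (fun n => ab n * ∑ m ∈ Finset.range n, B m) z =
      ev (fun n => ab n * ((∑ m ∈ Finset.range n, B m) / n)) z / 2 + z * ev (fun n => ab n * B n) z := by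
  have p1 : PB (fun n => ab n * ∑ m ∈ Finset.range n, B m) := PB_ab.mul hB.sum
  have p2 : PB (fun n => ab n * ((∑ m ∈ Finset.range n, B m) / n)) := PB_ab.mul hB.sum.div
  have p3 : PB (fun n => ab n * B n) := PB_ab.mul hB
  have p2' : PB (fun n => (-1 / 2 : ℂ) * (ab n * ((∑ m ∈ Finset.range n, B m) / n))) :=
    (PB.const _).mul p2
  have h := ev_shift (B := fun n => (ab n * ∑ m ∈ Finset.range n, B m) + ab n * B n)
    (p1.add p2') (by simp) (fun n => ?_) h0.le h1
  · rw [ev_add p1 p2' h0.le h1, ev_add p1 p3 h0.le h1, ev_smul] at h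
    linear_combination h
  · rw [Finset.sum_range_succ]
    have c : ((n : ℂ) + 1) ≠ 0 := by exact_mod_cast n.succ_ne_zero
    have := ab_succ n
    push_cast
    field_simp
    linear_combination ((∑ m ∈ Finset.range n, B m) + B n) * this

lemma zz2 {x : ℝ} : ((zz 2 x : ℝ) : ℂ) = 4 * x ^ 2 / (1 + x ^ 2) ^ 2 := by
  unfold zz; push_cast; ring

def JJ (B : ℕ → ℂ) (x : ℝ) : ℂ :=
  ((1 - x ^ 2) / (2 * x) : ℂ) * ev (fun n => ab n * ((∑ m ∈ Finset.range n, B m) / n)) (zz 2 x)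

lemma JJ_deriv {B : ℕ → ℂ} (hB : PB B) {x : ℝ} (h0 : 0 < x) (h1 : x < 1) :
    HasDerivAt (JJ B) (4 / (1 + x ^ 2) * ev (fun n => ab n * B n) (zz 2 x)) x := by
  have p2 : PB (fun n => ab n * ((∑ m ∈ Finset.range n, B m) / n)) := PB_ab.mul hB.sum.div
  obtain ⟨c1, c2, c3, c4, c5, -⟩ := cne h0 h1
  have hd := evz_deriv 2 two_ne_zero p2 h0 h1
  have hid : HasDerivAt (fun y : ℝ => (y : ℂ)) 1 x := Complex.ofRealCLM.hasDerivAt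
  have ha : HasDerivAt (fun y : ℝ => ((1 - y ^ 2) / (2 * y) : ℂ))
      (((-(2 * x)) * (2 * x) - (1 - x ^ 2) * 2) / (2 * x) ^ 2) x := by
    refine (((hid.pow 2).const_sub 1).div (hid.const_mul 2) (by simpa using c1)).congr_deriv ?_
    simp
  refine (ha.mul hd).congr_deriv ?_
  have e : (fun n : ℕ => (n : ℂ) * (ab n * ((∑ m ∈ Finset.range n, B m) / n))) =
      fun n => ab n * ∑ m ∈ Finset.range n, B m := by
    have := mul_div_nat (B := fun n => ab n * ∑ m ∈ Finset.range n, B m) (by simp)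
    rw [← this]
    funext n
    ring_nf
  rw [e]
  have hk := key_rel hB (zz_pos 2 h0) (zz_lt 2 two_ne_zero h0 h1)
  revert hk
  generalize ev (fun n => ab n * ∑ m ∈ Finset.range n, B m) (zz 2 x) = K
  generalize ev (fun n => ab n * ((∑ m ∈ Finset.range n, B m) / n)) (zz 2 x) = G
  generalize ev (fun n => ab n * B n) (zz 2 x) = L'
  intro hk
  rw [zz2] at hk
  unfold kk
  push_cast
  field_simp at hk ⊢
  linear_combination hk

lemma JJ_tendsto {B : ℕ → ℂ} (hB : PB B) :
    Filter.Tendsto (JJ B) (nhdsWithin 0 (Set.Ioi 0)) (nhds 0) := by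
  have p2 : PB (fun n => ab n * ((∑ m ∈ Finset.range n, B m) / n)) := PB_ab.mul hB.sum.div
  have h1 := evz_tendsto 2 two_ne_zero p2.shift
  have h2 : Filter.Tendsto (fun x : ℝ => (2 * x * (1 - x ^ 2) / (1 + x ^ 2) ^ 2 : ℂ))
      (nhdsWithin 0 (Set.Ioi 0)) (nhds 0) := by
    have : ContinuousAt (fun x : ℝ => (2 * x * (1 - x ^ 2) / (1 + x ^ 2) ^ 2 : ℂ)) 0 := by
      refine ContinuousAt.div (by fun_prop) (by fun_prop) ?_
      simp
    have := this.tendsto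
    simp only [Complex.ofReal_zero, mul_zero, zero_mul, zero_div] at this
    exact this.mono_left nhdsWithin_le_nhds
  have h3 := h2.mul h1
  rw [zero_mul] at h3
  refine h3.congr' ?_
  filter_upwards [Ioo_mem_nhdsGT (show (0:ℝ) < 1 by norm_num)] with x hx
  obtain ⟨c1, c2, c3, c4, c5, -⟩ := cne hx.1 hx.2
  unfold JJ
  rw [ev_shift p2 (by simp) (fun n => rfl) (zz_pos 2 hx.1).le (zz_lt 2 two_ne_zero hx.1 hx.2), zz2]
  field_simp
  ring

/-- the form `i·dθ` -/
lemma IW_theta {k : ℕ} {F : ℝ → ℂ} (hF : Wp 4 k F) :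
    IW 4 (k + 1) (fun x => 2 * Complex.I / (1 + x ^ 2) * F x) := by
  have h1 := IW_S (N := 4) four_pos (s := Complex.I) (by simp) hF
  have h2 := (IW_S (N := 4) four_pos (s := -Complex.I) (by rw [neg_pow]; norm_num) hF).smul (-1)
  refine (h1.add four_pos h2).congr fun x h0 h1 => ?_
  obtain ⟨c1, c2, c3, c4, c5, c6, c7⟩ := cne h0 h1
  have e : (1 : ℂ) - -Complex.I * x = 1 + Complex.I * x := by ring
  have e2 : (1 : ℂ) + x ^ 2 = (1 - Complex.I * x) * (1 + Complex.I * x) := by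
    linear_combination ((x : ℂ) ^ 2) * Complex.I_sq
  rw [e, e2]
  push_cast
  field_simp
  ring

lemma IW_cot {k : ℕ} {F : ℝ → ℂ} (hF : Wp 4 (k + 1) F) :
    IW 4 (k + 2) (fun x => 2 * (1 - x ^ 2) / (1 + x ^ 2) / x * F x) := by
  have h0 := (IW_0 (N := 4) four_pos hF).smul 2
  have h1 := (IW_S (N := 4) four_pos (s := Complex.I) (by simp) hF).smul 2
  have h2 := (IW_S (N := 4) four_pos (s := -Complex.I) (by rw [neg_pow]; norm_num) hF).smul 2
  refine ((h0.add four_pos h1).add four_pos h2).congr fun x h0 h1 => ?_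
  obtain ⟨c1, c2, c3, c4, c5, c6, c7⟩ := cne h0 h1
  have e : (1 : ℂ) - -Complex.I * x = 1 + Complex.I * x := by ring
  have e2 : (1 : ℂ) + x ^ 2 = (1 - Complex.I * x) * (1 + Complex.I * x) := by
    linear_combination ((x : ℂ) ^ 2) * Complex.I_sq
  have e3 : (1 : ℂ) - x ^ 2 = 1 + Complex.I ^ 2 * x ^ 2 := by
    rw [Complex.I_sq]; ring
  rw [e, e2, e3]
  push_cast
  field_simp
  ring

lemma IW_tan {k : ℕ} {F : ℝ → ℂ} (hF : Wp 4 k F) :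
    IW 4 (k + 1) (fun x => 4 * x / ((1 - x ^ 2) * (1 + x ^ 2)) * F x) := by
  have h1 := (IW_S (N := 4) four_pos (s := Complex.I) (by simp) hF).smul (-1)
  have h2 := (IW_S (N := 4) four_pos (s := -Complex.I) (by rw [neg_pow]; norm_num) hF).smul (-1)
  have h3 := (IW_S (N := 4) four_pos (s := 1) (by simp) hF)
  have h4 := (IW_S (N := 4) four_pos (s := -1) (by rw [neg_pow]; norm_num) hF)
  refine (((h1.add four_pos h2).add four_pos h3).add four_pos h4).congr fun x h0 h1 => ?_
  obtain ⟨c1, c2, c3, c4, c5, c6, c7⟩ := cne h0 h1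
  have e : (1 : ℂ) - -Complex.I * x = 1 + Complex.I * x := by ring
  have e1 : (1 : ℂ) - 1 * x = 1 - x := by ring
  have e1' : (1 : ℂ) - -1 * x = 1 + x := by ring
  have e2 : (1 : ℂ) + x ^ 2 = (1 - Complex.I * x) * (1 + Complex.I * x) := by
    linear_combination ((x : ℂ) ^ 2) * Complex.I_sq
  have t1 : Complex.I / (1 - Complex.I * x) + -Complex.I / (1 + Complex.I * x) =
      -2 * x / (1 + x ^ 2) := by
    rw [e2, div_add_div _ _ c6 c7, div_left_inj' (mul_ne_zero c6 c7)]
    linear_combination (2 * (x : ℂ)) * Complex.I_sq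
  have t2 : (1 : ℂ) / (1 - x) + -1 / (1 + x) = 2 * x / (1 - x ^ 2) := by
    field_simp
    ring
  have t3 : (4 * x / ((1 - x ^ 2) * (1 + x ^ 2)) : ℂ) = 2 * x / (1 - x ^ 2) - -2 * x / (1 + x ^ 2) := by
    field_simp
    ring
  rw [e, e1, e1', t3, ← t1, ← t2]
  push_cast
  ring

def EE (k : ℕ) (B : ℕ → ℂ) : Prop := Wp 4 k (fun x => ev (fun n => ab n * B n) (zz 2 x))

def TS (k : ℕ) (B : ℕ → ℂ) : Prop := ∃ J, Wp 4 k J ∧ ∀ x, 0 < x → x < 1 →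
  ev (fun n => ab n * B n) (zz 2 x) = 2 * x / (1 - x ^ 2) * (Complex.I * J x)

lemma TS_of_IW {k : ℕ} {B : ℕ → ℂ} (hB : PB B)
    (h : IW 4 (k + 1) (fun x => -Complex.I * (4 / (1 + x ^ 2) * ev (fun n => ab n * B n) (zz 2 x)))) :
    TS (k + 1) (fun n => (∑ m ∈ Finset.range n, B m) / (n : ℂ)) := by
  refine ⟨fun x => -Complex.I * JJ B x, h.eq (fun x h0 h1 => (JJ_deriv hB h0 h1).const_mul _) ?_, ?_⟩
  · simpa using (JJ_tendsto hB).const_mul (-Complex.I)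
  · intro x h0 h1
    obtain ⟨c1, c2, c3, c4, c5, c6, c7⟩ := cne h0 h1
    have : Complex.I * (-Complex.I * JJ B x) = JJ B x := by
      linear_combination (-JJ B x) * Complex.I_sq
    rw [this]
    unfold JJ
    field_simp

lemma EE.sig {k : ℕ} {B : ℕ → ℂ} (hB : PB B) (h : EE k B) :
    TS (k + 1) (fun n => (∑ m ∈ Finset.range n, B m) / (n : ℂ)) := by
  refine TS_of_IW hB (((IW_theta h).smul (-2)).congr fun x h0 h1 => ?_)
  push_cast
  ring

lemma TS.sig {k : ℕ} {B : ℕ → ℂ} (hB : PB B) (h : TS k B) :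
    TS (k + 1) (fun n => (∑ m ∈ Finset.range n, B m) / (n : ℂ)) := by
  obtain ⟨J, hJ, h⟩ := h
  refine TS_of_IW hB (((IW_tan hJ).smul 2).congr fun x h0 h1 => ?_)
  rw [h x h0 h1]
  obtain ⟨c1, c2, c3, c4, c5, c6, c7⟩ := cne h0 h1
  push_cast
  field_simp
  linear_combination (-J x) * Complex.I_sq

lemma E_div {k : ℕ} {B : ℕ → ℂ} (hB : Ch (k + 1) B) {g : ℝ → ℂ} (hg : IW 4 (k + 2) g)
    (h : ∀ x, 0 < x → x < 1 →
      2 * (1 - x ^ 2) / (1 + x ^ 2) / x * ev (fun n => ab n * B n) (zz 2 x) = g x) :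
    EE (k + 2) (fun n => B n / (n : ℂ)) := by
  have hP : PB (fun n => ab n * (B n / n)) := PB_ab.mul hB.PB.div
  refine hg.eq (fun x h0 h1 => ?_) ?_
  · refine (evz_deriv 2 two_ne_zero hP h0 h1).congr_deriv ?_
    rw [← h x h0 h1]
    have e : (fun n : ℕ => (n : ℂ) * (ab n * (B n / n))) = fun n => ab n * B n := by
      have := mul_div_nat (B := fun n => ab n * B n) (by simp [hB.zero])
      rw [← this]
      funext n
      ring_nf
    rw [e]
    unfold kk
    push_cast
    ring
  · simpa [hB.zero] using evz_tendsto 2 two_ne_zero hP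

lemma EE.div {k : ℕ} {B : ℕ → ℂ} (hB : Ch (k + 1) B) (h : EE (k + 1) B) :
    EE (k + 2) (fun n => B n / (n : ℂ)) :=
  E_div hB (IW_cot h) fun _ _ _ => rfl

lemma TS.div {k : ℕ} {B : ℕ → ℂ} (hB : Ch (k + 1) B) (h : TS (k + 1) B) :
    EE (k + 2) (fun n => B n / (n : ℂ)) := by
  obtain ⟨J, hJ, h⟩ := h
  refine E_div hB ((IW_theta hJ).smul 2) fun x h0 h1 => ?_
  rw [h x h0 h1]
  obtain ⟨c1, c2, c3, c4, c5, c6, c7⟩ := cne h0 h1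
  push_cast
  field_simp
  

lemma thm2' {k : ℕ} {B : ℕ → ℂ} (h : Ch k B) : EE k B ∨ TS k B := by
  induction h with
  | base =>
    refine Or.inl ((Wp_one 4).congr fun x _ _ => ?_)
    rw [← ev_delta0 (zz 2 x)]
    congr 1
    funext n
    rcases n with _ | n <;> simp [delta0, ab]
  | sig hB ih => exact Or.inr (ih.elim (EE.sig hB.PB) (TS.sig hB.PB))
  | div hB ih => exact Or.inl (ih.elim (EE.div hB) (TS.div hB))

theorem thm2 {k : ℕ} {B : ℕ → ℂ} (h : Ch (k + 1) B) : EE (k + 2) (fun n => B n / (n : ℂ)) :=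
  (thm2' h).elim (EE.div h) (TS.div h)


/-! ### Stuffle -/

def QQ (k : ℕ) : Submodule ℚ (ℕ → ℂ) := Submodule.span ℚ {B | Ch k B}

def SigL : (ℕ → ℂ) →ₗ[ℚ] (ℕ → ℂ) where
  toFun B n := (∑ m ∈ Finset.range n, B m) / (n : ℂ)
  map_add' c d := by funext l; simp [Finset.sum_add_distrib, add_div]
  map_smul' q c := by
    funext l
    simp [Rat.smul_def, mul_div_assoc, Finset.mul_sum, Finset.sum_div]

def MulL (h : ℕ → ℂ) : (ℕ → ℂ) →ₗ[ℚ] (ℕ → ℂ) where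
  toFun B n := B n * h n
  map_add' c d := by funext l; simp [add_mul]
  map_smul' q c := by
    funext l
    simp [Rat.smul_def, mul_assoc]

lemma Q_sig {k : ℕ} {B : ℕ → ℂ} (hB : B ∈ QQ k) :
    (fun n => (∑ m ∈ Finset.range n, B m) / (n : ℂ)) ∈ QQ (k + 1) := by
  have : QQ k ≤ (QQ (k + 1)).comap SigL :=
    Submodule.span_le.2 fun B hB => Submodule.subset_span (Ch.sig hB)
  exact this hB

lemma Q_div {k : ℕ} {B : ℕ → ℂ} (hB : B ∈ QQ (k + 1)) :
    (fun n => B n / (n : ℂ)) ∈ QQ (k + 2) := by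
  have : QQ (k + 1) ≤ (QQ (k + 2)).comap Op0 :=
    Submodule.span_le.2 fun B hB => Submodule.subset_span (Ch.div hB)
  exact this hB

lemma Q_divpow {k : ℕ} {B : ℕ → ℂ} (hB : B ∈ QQ (k + 1)) (t : ℕ) :
    (fun n => B n / (n : ℂ) ^ t) ∈ QQ (k + 1 + t) := by
  induction t with
  | zero => simpa using hB
  | succ t ih =>
    have := Q_div (k := k + t) (by rwa [show k + t + 1 = k + 1 + t by ring])
    rw [show k + 1 + (t + 1) = k + t + 2 by ring]
    convert this using 2 with n
    rw [pow_succ, div_div]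

def hh (r n : ℕ) : ℂ := ∑ m ∈ Finset.range n, 1 / (m : ℂ) ^ r

lemma prod_sum (B : ℕ → ℂ) (r n : ℕ) : (∑ m ∈ Finset.range n, B m) * hh r n =
    ∑ m ∈ Finset.range n, (B m * hh r m + B m / (m : ℂ) ^ r +
      (∑ j ∈ Finset.range m, B j) / (m : ℂ) ^ r) := by
  induction n with
  | zero => simp [hh]
  | succ n ih =>
    rw [Finset.sum_range_succ _ n, Finset.sum_range_succ _ n, ← ih]
    have : hh r (n + 1) = hh r n + 1 / (n : ℂ) ^ r := by
      unfold hh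
      rw [Finset.sum_range_succ]
    rw [this]
    ring

lemma delta0_mul (g : ℕ → ℂ) (h : g 0 = 0) : (fun n => delta0 n * g n) = 0 := by
  funext n
  rcases n with _ | n
  · simp [h]
  · simp [delta0]

lemma stuffle {k : ℕ} {B : ℕ → ℂ} (hB : Ch k B) (t : ℕ) :
    (fun n => B n * hh (t + 1) n) ∈ QQ (k + (t + 1)) := by
  induction hB with
  | base =>
    rw [delta0_mul _ (by simp [hh])]
    exact Submodule.zero_mem _
  | @sig k B hB ih =>
    have e : (fun n => (∑ m ∈ Finset.range n, B m) / (n : ℂ) * hh (t + 1) n) =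
        fun n => (∑ m ∈ Finset.range n, (B m * hh (t + 1) m + B m / (m : ℂ) ^ (t + 1) +
      (∑ j ∈ Finset.range m, B j) / (m : ℂ) ^ (t + 1))) / (n : ℂ) := by
      funext n
      rw [← prod_sum]
      ring
    rw [e, show k + 1 + (t + 1) = k + (t + 1) + 1 by ring]
    refine Q_sig (B := fun m => (B m * hh (t + 1) m + B m / (m : ℂ) ^ (t + 1) +
      (∑ j ∈ Finset.range m, B j) / (m : ℂ) ^ (t + 1))) ?_
    refine Submodule.add_mem _ (Submodule.add_mem _ ih ?_) ?_
    · cases k with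
      | zero =>
        cases hB
        have := delta0_mul (fun m => 1 / (m : ℂ) ^ (t + 1)) (by simp)
        simp only [mul_one_div] at this
        rw [this]
        exact Submodule.zero_mem _
      | succ k => exact Q_divpow (Submodule.subset_span hB) (t + 1)
    · have := Q_divpow (Q_sig (Submodule.subset_span hB)) t
      rw [show k + (t + 1) = k + 1 + t by ring]
      convert this using 2 with n
      rw [pow_succ, div_div, mul_comm]
  | @div k B hB ih =>
    have := Q_div (k := k + (t + 1)) (by rwa [show k + (t + 1) + 1 = k + 1 + (t + 1) by ring])
    rw [show k + 2 + (t + 1) = k + (t + 1) + 2 by ring]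
    convert this using 2 with n
    ring

lemma Q_mul {k : ℕ} {B : ℕ → ℂ} (hB : B ∈ QQ k) {r : ℕ} (hr : 0 < r) :
    (fun n => B n * hh r n) ∈ QQ (k + r) := by
  obtain ⟨t, rfl⟩ := Nat.exists_eq_succ_of_ne_zero hr.ne'
  have : QQ k ≤ (QQ (k + (t + 1))).comap (MulL (hh (t + 1))) :=
    Submodule.span_le.2 fun B hB => stuffle hB t
  exact this hB

lemma Q_prod {M : ℕ} (r : Fin M → ℕ) (hr : ∀ j, 0 < r j) {k : ℕ} {B : ℕ → ℂ} (hB : B ∈ QQ k) :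
    (fun n => B n * ∏ j, hh (r j) n) ∈ QQ (k + ∑ j, r j) := by
  induction M generalizing k B with
  | zero => simpa using hB
  | succ M ih =>
    have := ih (fun j => r j.succ) (fun j => hr _) (Q_mul hB (hr 0))
    rw [Fin.sum_univ_succ, ← add_assoc]
    convert this using 2 with n
    rw [Fin.prod_univ_succ, mul_assoc]

lemma Q_pow (s : ℕ) (hs : 0 < s) : (fun n : ℕ => 1 / (n : ℂ) ^ s) ∈ QQ s := by
  obtain ⟨t, rfl⟩ := Nat.exists_eq_succ_of_ne_zero hs.ne'
  have := Q_divpow (Q_sig (Submodule.subset_span Ch.base)) t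
  rw [show t.succ = 0 + 1 + t by rw [Nat.succ_eq_add_one]; ring]
  convert this using 2 with n
  rcases n with _ | n
  · simp
  · rw [add_comm (0 + 1) t, zero_add, pow_succ, mul_comm, ← div_div]
    simp [delta0]

lemma Q_thm1 {k : ℕ} {B : ℕ → ℂ} (hB : B ∈ QQ k) :
    PB B ∧ Wp 2 k (fun x => ev B (zz 1 x)) := by
  refine Submodule.span_induction (p := fun B _ => PB B ∧ Wp 2 k (fun x => ev B (zz 1 x)))
    ?_ ?_ ?_ ?_ hB
  · exact fun B hB => ⟨Ch.PB hB, thm1 hB⟩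
  · refine ⟨PB.const 0, 0, Submodule.zero_mem _, fun x _ _ => ?_⟩
    simp [ev]
  · rintro B C _ _ ⟨h1, h2⟩ ⟨h3, h4⟩
    refine ⟨h1.add h3, (h2.add two_pos h4).congr fun x h0 h1' => ?_⟩
    exact ev_add h1 h3 (zz_pos 1 h0).le (zz_lt 1 one_ne_zero h0 h1')
  · rintro q B _ ⟨h1, h2⟩
    refine ⟨(PB.const (q : ℂ)).mul h1, (h2.smul q).congr fun x h0 h1' => ?_⟩
    exact ev_smul (q : ℂ) B _

lemma Q_thm2 {k : ℕ} {B : ℕ → ℂ} (hB : B ∈ QQ (k + 1)) :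
    PB B ∧ EE (k + 2) (fun n => B n / (n : ℂ)) := by
  refine Submodule.span_induction (p := fun B _ => PB B ∧ EE (k + 2) (fun n => B n / (n : ℂ)))
    ?_ ?_ ?_ ?_ hB
  · exact fun B hB => ⟨Ch.PB hB, thm2 hB⟩
  · refine ⟨PB.const 0, 0, Submodule.zero_mem _, fun x _ _ => ?_⟩
    simp [ev]
  · rintro B C _ _ ⟨h1, h2⟩ ⟨h3, h4⟩
    refine ⟨h1.add h3, (Wp.add four_pos h2 h4).congr fun x h0 h1' => ?_⟩
    rw [← ev_add (PB_ab.mul h1.div) (PB_ab.mul h3.div) (zz_pos 2 h0).le (zz_lt 2 two_ne_zero h0 h1')]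
    congr 1
    funext n
    simp only [Pi.add_apply]
    ring
  · rintro q B _ ⟨h1, h2⟩
    refine ⟨(PB.const (q : ℂ)).mul h1, (Wp.smul q h2).congr fun x h0 h1' => ?_⟩
    rw [← ev_smul]
    congr 1
    funext n
    simp only [Pi.smul_apply, Rat.smul_def]
    ring

/-! ### Final integration -/

def yy (p : ℕ) (x : ℝ) : ℝ := 4 * x ^ (p - 1) / (1 + x ^ p) ^ 2

def abr (n : ℕ) : ℝ := 4 ^ n / (Nat.centralBinom n : ℝ)

lemma abr_cast (n : ℕ) : ((abr n : ℝ) : ℂ) = ab n := by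
  unfold abr ab; push_cast; rfl

lemma abr_succ (n : ℕ) : (2 * (n : ℝ) + 1) * abr (n + 1) = 2 * ((n : ℝ) + 1) * abr n := by
  have := ab_succ n
  rw [← abr_cast, ← abr_cast] at this
  exact_mod_cast this

lemma kk_deriv (p : ℕ) {x : ℝ} (h0 : 0 ≤ x) :
    HasDerivAt (kk p) (-(p : ℝ) * yy p x / 2) x := by
  have h := hasDerivAt_pow p x
  have hp : (1 + x ^ p) ≠ 0 := by positivity
  refine ((h.const_sub 1).div (h.const_add 1) hp).congr_deriv ?_
  unfold yy
  field_simp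
  ring

lemma zz_deriv' (p : ℕ) {x : ℝ} (h0 : 0 ≤ x) :
    HasDerivAt (zz p) ((p : ℝ) * kk p x * yy p x) x := by
  have h := hasDerivAt_pow p x
  have hp : (1 + x ^ p) ≠ 0 := by positivity
  refine ((h.const_mul 4).div ((h.const_add 1).pow 2) (pow_ne_zero 2 hp)).congr_deriv ?_
  unfold yy kk
  simp only [Pi.pow_apply]
  field_simp
  ring

lemma kk_sq (p : ℕ) {x : ℝ} (h0 : 0 ≤ x) : kk p x ^ 2 = 1 - zz p x := by
  have hp : (1 + x ^ p) ≠ 0 := by positivity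
  unfold kk zz
  field_simp
  ring

lemma yy_cont (p : ℕ) : ContinuousOn (yy p) (Set.Icc 0 1) := by
  unfold yy
  refine ContinuousOn.div (by fun_prop) (by fun_prop) fun x hx => ?_
  have := hx.1
  positivity

lemma zy_cont (p n : ℕ) : ContinuousOn (fun x => zz p x ^ n * yy p x) (Set.Icc 0 1) := by
  refine ContinuousOn.mul (ContinuousOn.pow ?_ n) (yy_cont p)
  exact fun x hx => (zz_deriv' p hx.1).continuousAt.continuousWithinAt

lemma zy_int (p : ℕ) (hp : p ≠ 0) (n : ℕ) :
    ∫ x in (0:ℝ)..1, zz p x ^ n * yy p x = abr (n + 1) / ((n + 1) * p) := by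
  have hp' : (p : ℝ) ≠ 0 := by exact_mod_cast hp
  have hint : ∀ n, IntervalIntegrable (fun x => zz p x ^ n * yy p x) volume 0 1 := by
    intro n
    refine ContinuousOn.intervalIntegrable ?_
    rw [Set.uIcc_of_le zero_le_one]
    exact zy_cont p n
  have k1 : kk p 1 = 0 := by simp [kk]
  have k0 : kk p 0 = 1 := by simp [kk, hp]
  have z0 : zz p 0 = 0 := by simp [zz, hp]
  induction n with
  | zero =>
    have h := intervalIntegral.integral_eq_sub_of_hasDerivAt (a := (0:ℝ)) (b := 1)
      (f := fun x => (-2 / p) * kk p x) (f' := fun x => zz p x ^ 0 * yy p x) ?_ (hint 0)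
    · rw [h, k1, k0]
      norm_num [abr, Nat.centralBinom]
      ring
    · intro x hx
      rw [Set.uIcc_of_le zero_le_one] at hx
      refine ((kk_deriv p hx.1).const_mul (-2 / (p:ℝ))).congr_deriv ?_
      field_simp
  | succ n ih =>
    have h := intervalIntegral.integral_eq_sub_of_hasDerivAt (a := (0:ℝ)) (b := 1)
      (f := fun x => zz p x ^ (n + 1) * kk p x)
      (f' := fun x => (p * ((n:ℝ) + 1)) * (zz p x ^ n * yy p x) -
        (p * ((n:ℝ) + 3 / 2)) * (zz p x ^ (n + 1) * yy p x)) ?_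
        (((hint n).const_mul _).sub ((hint (n + 1)).const_mul _))
    · rw [intervalIntegral.integral_sub ((hint n).const_mul _) ((hint (n + 1)).const_mul _),
        intervalIntegral.integral_const_mul, intervalIntegral.integral_const_mul, ih, k1, k0, z0] at h
      have ha := abr_succ (n + 1)
      push_cast at ha ⊢
      have n1 : (n : ℝ) + 1 ≠ 0 := by positivity
      have n2 : (n : ℝ) + 1 + 1 ≠ 0 := by positivity
      have n3 : 2 * ((n : ℝ) + 1) + 1 ≠ 0 := by positivity
      rw [eq_div_iff (by positivity)]
      simp only [ne_eq, Nat.add_eq_zero_iff, one_ne_zero, and_false, not_false_eq_true, zero_pow,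
        zero_mul, mul_zero, sub_zero] at h
      field_simp at h
      have : (2 * ((n : ℝ) + 1) + 1) * ((∫ x in (0:ℝ)..1, zz p x ^ (n + 1) * yy p x) * (((n : ℝ) + 1 + 1) * p)
          - abr (n + 1 + 1)) = 0 := by
        linear_combination (-1) * ha - ((n:ℝ) + 2) * h
      rcases mul_eq_zero.1 this with h' | h'
      · exact absurd h' n3
      · linarith
    · intro x hx
      rw [Set.uIcc_of_le zero_le_one] at hx
      refine (((zz_deriv' p hx.1).pow (n + 1)).mul (kk_deriv p hx.1)).congr_deriv ?_
      have := kk_sq p hx.1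
      simp only [Pi.pow_apply, Nat.add_sub_cancel]
      push_cast
      linear_combination (p * ((n:ℝ) + 1)) * (zz p x ^ n * yy p x) * this



lemma zz_yy (p : ℕ) (hp : p ≠ 0) (x : ℝ) : zz p x = x * yy p x := by
  obtain ⟨q, rfl⟩ := Nat.exists_eq_succ_of_ne_zero hp
  unfold zz yy
  simp only [Nat.succ_eq_add_one, Nat.add_sub_cancel]
  ring

lemma FIN (p : ℕ) (hp : p ≠ 0) (A : ℕ → ℝ) (hA0 : ∀ n, 0 ≤ A n) (hAz : A 0 = 0)
    (hA : PB (fun n => (A n : ℂ))) (c : ℕ → ℂ) (hc : Bd c) (hcz : c 0 = 0)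
    (h : ∀ x, 0 < x → x < 1 → ev (fun n => (A n : ℂ)) (zz p x) = ev c x) :
    HasSum (fun n : ℕ => (A n : ℂ) * ab n / n) (p * ∑' l : ℕ, c l / (l : ℂ)) := by
  have hp' : (p : ℝ) ≠ 0 := by exact_mod_cast hp
  set μ : Measure ℝ := volume.restrict (Set.Ioo 0 1) with hμ
  have hint : ∀ f : ℝ → ℂ, ∫ x, f x ∂μ = ∫ x in (0:ℝ)..1, f x := by
    intro f
    rw [intervalIntegral.integral_of_le zero_le_one, integral_Ioc_eq_integral_Ioo]
  have hintr : ∀ f : ℝ → ℝ, ∫ x, f x ∂μ = ∫ x in (0:ℝ)..1, f x := by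
    intro f
    rw [intervalIntegral.integral_of_le zero_le_one, integral_Ioc_eq_integral_Ioo]
  have hcont : ∀ f : ℝ → ℂ, ContinuousOn f (Set.Icc 0 1) → Integrable f μ := by
    intro f hf
    exact (hf.integrableOn_Icc).mono_set Set.Ioo_subset_Icc_self
  let F : ℕ → ℝ → ℂ := fun n x => ((A (n+1) * (zz p x ^ n * yy p x) : ℝ) : ℂ)
  let C : ℕ → ℝ → ℂ := fun l x => c (l+1) * (x : ℂ) ^ l
  have hFi : ∀ n, Integrable (F n) μ := by
    intro n
    apply hcont
    exact Complex.continuous_ofReal.comp_continuousOn (continuousOn_const.mul (zy_cont p n))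
  have hCi : ∀ n, Integrable (C n) μ := by
    intro n
    apply hcont
    apply Continuous.continuousOn
    fun_prop
  have hFI : ∀ n, ∫ x, F n x ∂μ = (A (n+1) : ℂ) * ab (n+1) / ((n+1) * p) := by
    intro n
    have : ∫ x, F n x ∂μ = ((∫ x, A (n+1) * (zz p x ^ n * yy p x) ∂μ : ℝ) : ℂ) := integral_ofReal
    rw [this, integral_const_mul, hintr, zy_int p hp, ← abr_cast]
    push_cast
    ring
  have hCI : ∀ n, ∫ x, C n x ∂μ = c (n+1) / ((n+1 : ℕ) : ℂ) := by
    intro n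
    have : ∫ x, C n x ∂μ = c (n+1) * ((∫ x, x ^ n ∂μ : ℝ) : ℂ) := by
      have h1 : ((∫ x, x ^ n ∂μ : ℝ) : ℂ) = ∫ x, ((x ^ n : ℝ) : ℂ) ∂μ := integral_ofReal.symm
      rw [h1, ← integral_const_mul]
      congr 1; funext x; simp [C]
    rw [this, hintr, integral_pow]
    push_cast
    simp
    ring
  have hCN : ∀ n, ∫ x, ‖C n x‖ ∂μ = ‖c (n+1)‖ / ((n+1 : ℕ) : ℝ) := by
    intro n
    have : ∫ x, ‖C n x‖ ∂μ = ∫ x, ‖c (n+1)‖ * x ^ n ∂μ := by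
      apply setIntegral_congr_fun measurableSet_Ioo
      intro x hx
      simp [C, abs_of_pos hx.1]
    rw [this, integral_const_mul, hintr, integral_pow]
    push_cast
    simp
    ring
  have hCsum : Summable (fun n => ∫ x, ‖C n x‖ ∂μ) := by
    simp only [hCN]
    exact (summable_nat_add_iff (f := fun l : ℕ => ‖c l‖ / (l : ℝ)) 1).2 hc.summable
  have hpt : ∀ x, 0 < x → x < 1 → HasSum (fun n => F n x) (∑' l, C l x) := by
    intro x h0 h1
    have hz0 := zz_pos p h0
    have hz1 := zz_lt p hp h0 h1
    have e := h x h0 h1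
    rw [ev_shift (B := fun n => (A (n+1) : ℂ)) hA (by simp [hAz]) (fun n => rfl) hz0.le hz1,
      ev_shift (B := fun n => c (n+1)) hc.PB hcz (fun n => rfl) h0.le h1] at e
    have hx : (x : ℂ) ≠ 0 := by exact_mod_cast h0.ne'
    have e2 : (yy p x : ℂ) * ev (fun n => (A (n+1) : ℂ)) (zz p x) = ev (fun n => c (n+1)) x := by
      apply mul_left_cancel₀ hx
      rw [← e, ← mul_assoc]
      congr 1
      rw [zz_yy p hp x]; push_cast; rfl
    have hs := (PB.summable hA.shift hz0.le hz1).hasSum.mul_left (yy p x : ℂ)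
    have e3 : (yy p x : ℂ) * (∑' n : ℕ, (A (n+1) : ℂ) * (zz p x : ℂ) ^ n) = ∑' l, C l x := e2
    rw [e3] at hs
    have e5 : (fun n => F n x) =
        fun n => (yy p x : ℂ) * ((A (n+1) : ℂ) * (zz p x : ℂ) ^ n) := by
      funext n
      simp only [F]; push_cast; ring
    rw [e5]
    exact hs
  have hCfin : ∑' n, ∫⁻ x, ‖C n x‖ₑ ∂μ ≠ ⊤ := by
    have : ∀ n, ∫⁻ x, ‖C n x‖ₑ ∂μ = ENNReal.ofReal (∫ x, ‖C n x‖ ∂μ) := fun n =>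
      (ofReal_integral_norm_eq_lintegral_enorm (hCi n)).symm
    simp only [this]
    exact hCsum.tsum_ofReal_ne_top
  have hFfin : ∑' n, ∫⁻ x, ‖F n x‖ₑ ∂μ ≠ ⊤ := by
    refine ne_top_of_le_ne_top hCfin ?_
    rw [← lintegral_tsum (fun n => (hFi n).aestronglyMeasurable.enorm),
      ← lintegral_tsum (fun n => (hCi n).aestronglyMeasurable.enorm)]
    apply setLIntegral_mono' measurableSet_Ioo
    intro x hx
    have hF := hpt x hx.1 hx.2
    have hzn := (zz_pos p hx.1).le
    have hyn : 0 ≤ yy p x := by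
      have := hx.1
      unfold yy; positivity
    have hre : HasSum (fun n => A (n+1) * (zz p x ^ n * yy p x)) (∑' l, C l x).re :=
      (Complex.hasSum_re hF)
    have hnn : ∀ n, 0 ≤ A (n+1) * (zz p x ^ n * yy p x) := fun n =>
      mul_nonneg (hA0 _) (mul_nonneg (pow_nonneg hzn _) hyn)
    have e1 : ∀ n, ‖F n x‖ₑ = ENNReal.ofReal (A (n+1) * (zz p x ^ n * yy p x)) := by
      intro n
      rw [← ofReal_norm]
      simp only [F]
      rw [Complex.norm_real, Real.norm_of_nonneg (hnn n)]
    simp only [e1]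
    rw [← ENNReal.ofReal_tsum_of_nonneg hnn hre.summable, hre.tsum_eq]
    have hsn : Summable (fun l => ‖C l x‖) := by
      have := PB.summable_norm (hc.PB.shift) hx.1.le hx.2
      refine this.congr fun l => ?_
      simp [C, abs_of_pos hx.1]
    have : ∀ l, ‖C l x‖ₑ = ENNReal.ofReal ‖C l x‖ := fun l => (ofReal_norm _).symm
    simp only [this]
    rw [← ENNReal.ofReal_tsum_of_nonneg (fun _ => norm_nonneg _) hsn]
    apply ENNReal.ofReal_le_ofReal
    exact (Complex.re_le_norm _).trans (norm_tsum_le_tsum_norm hsn)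
  have hFsum : Summable (fun n => ∫ x, ‖F n x‖ ∂μ) := by
    have := ENNReal.summable_toReal hFfin
    refine this.congr fun n => ?_
    rw [integral_norm_eq_lintegral_enorm (hFi n).aestronglyMeasurable]
  have H1 := hasSum_integral_of_summable_integral_norm hFi hFsum
  have H2 := hasSum_integral_of_summable_integral_norm hCi hCsum
  have e : ∫ x, (∑' n, F n x) ∂μ = ∫ x, (∑' n, C n x) ∂μ := by
    apply setIntegral_congr_fun measurableSet_Ioo
    intro x hx
    exact (hpt x hx.1 hx.2).tsum_eq
  rw [e, ← H2.tsum_eq] at H1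
  simp only [hFI, hCI] at H1
  have hcs : Summable (fun l : ℕ => c l / (l : ℂ)) := by
    apply Summable.of_norm
    refine hc.summable.congr fun l => ?_
    simp
  have e4 : ∑' l : ℕ, c l / (l : ℂ) = ∑' n : ℕ, c (n+1) / ((n+1 : ℕ) : ℂ) := by
    rw [hcs.tsum_eq_zero_add]; simp
  have H3 := H1.mul_left (p : ℂ)
  rw [← e4] at H3
  rw [← hasSum_nat_add_iff' 1]
  simp only [Finset.sum_range_one, hAz, Nat.cast_zero, div_zero, sub_zero]
  have hpc : (p : ℂ) ≠ 0 := by exact_mod_cast hp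
  refine (congrArg (fun f => HasSum f _) (funext fun n => ?_)).mpr H3
  have hn : (n : ℂ) + 1 ≠ 0 := by exact_mod_cast Nat.succ_ne_zero n
  push_cast
  field_simp

def AR (M : ℕ) (r : Fin M → ℕ) (s n : ℕ) : ℝ := 1 / (n : ℝ) ^ s * ∏ j, H (r j) (n - 1)

lemma H_nonneg (r n : ℕ) : 0 ≤ H r n := by
  unfold H; exact Finset.sum_nonneg fun k _ => by positivity

lemma H_hh (r n : ℕ) (hr : 0 < r) : (H r n : ℂ) = hh r (n + 1) := by
  unfold H hh
  rw [Finset.sum_range_succ']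
  simp [hr.ne']

lemma AR_nonneg (M : ℕ) (r : Fin M → ℕ) (s n : ℕ) : 0 ≤ AR M r s n := by
  unfold AR
  exact mul_nonneg (by positivity) (Finset.prod_nonneg fun j _ => H_nonneg _ _)

lemma AR_zero (M : ℕ) (r : Fin M → ℕ) (s : ℕ) (hs : 0 < s) : AR M r s 0 = 0 := by
  simp [AR, hs.ne']

lemma AR_cast (M : ℕ) (r : Fin M → ℕ) (hr : ∀ j, 0 < r j) (s n : ℕ) (hs : 0 < s) :
    (AR M r s n : ℂ) = 1 / (n : ℂ) ^ s * ∏ j, hh (r j) n := by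
  unfold AR
  rcases n with _ | n
  · simp [hs.ne']
  · push_cast
    congr 1
    apply Finset.prod_congr rfl
    intro j _
    exact H_hh _ _ (hr j)

lemma AR_succ (M : ℕ) (r : Fin M → ℕ) (s n : ℕ) :
    (AR M r s (n+1) : ℂ) = 1 / ((n : ℂ) + 1) ^ s * ∏ j, (H (r j) n : ℂ) := by
  unfold AR
  push_cast
  simp

theorem part1 (M : ℕ) (r : Fin M → ℕ)
    (hr : ∀ j, 0 < r j) (s : ℕ) (hs : 0 < s) :
    (∑' n : ℕ, (2 : ℂ) ^ (2 * (n + 1)) * (∏ j, (H (r j) n : ℂ)) /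
        (((n : ℂ) + 1) ^ (s + 1) * (Nat.choose (2 * (n + 1)) (n + 1) : ℂ)) ∈
      zspan (s + ∑ j, r j + 1) 2) := by
  have hQ := Q_prod r hr (Q_pow s hs)
  have hfe : (fun n : ℕ => 1 / (n : ℂ) ^ s * ∏ j, hh (r j) n) = fun n => (AR M r s n : ℂ) := by
    funext n; rw [AR_cast M r hr s n hs]
  rw [hfe] at hQ
  obtain ⟨k', hk⟩ : ∃ k', s + ∑ j, r j = k' + 1 := ⟨s + ∑ j, r j - 1, by omega⟩
  rw [hk] at hQ ⊢
  obtain ⟨hPB, c, hc, hx⟩ := Q_thm1 hQ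
  have h1 := FIN 1 one_ne_zero (AR M r s) (AR_nonneg M r s) (AR_zero M r s hs) hPB c
    (VV_Bd (by norm_num) hc) (VV_zero hc) hx
  rw [← hasSum_nat_add_iff' 1] at h1
  have h2 := VV_tsum (by norm_num) hc
  have h3 := h1.tsum_eq
  simp only [Finset.sum_range_one, Nat.cast_zero, div_zero, sub_zero, Nat.cast_one, one_mul] at h3
  rw [← h3] at h2
  convert h2 using 1
  apply tsum_congr
  intro n
  rw [AR_succ]
  have hn : (n : ℂ) + 1 ≠ 0 := by exact_mod_cast Nat.succ_ne_zero n
  have hb : (Nat.centralBinom (n+1) : ℂ) ≠ 0 := by exact_mod_cast Nat.centralBinom_ne_zero _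
  rw [← Nat.centralBinom_eq_two_mul_choose, ab, pow_mul]
  push_cast
  field_simp
  norm_num
  ring

theorem part2 (M : ℕ) (r : Fin M → ℕ)
    (hr : ∀ j, 0 < r j) (s : ℕ) (hs : 0 < s) :
    (∑' n : ℕ, (2 : ℂ) ^ (4 * (n + 1)) * (∏ j, (H (r j) n : ℂ)) /
        (((n : ℂ) + 1) ^ (s + 2) * ((Nat.choose (2 * (n + 1)) (n + 1) : ℂ)) ^ 2) ∈
      zspan (s + ∑ j, r j + 2) 4) := by
  have hQ := Q_prod r hr (Q_pow s hs)
  have hfe : (fun n : ℕ => 1 / (n : ℂ) ^ s * ∏ j, hh (r j) n) = fun n => (AR M r s n : ℂ) := by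
    funext n; rw [AR_cast M r hr s n hs]
  rw [hfe] at hQ
  obtain ⟨k', hk⟩ : ∃ k', s + ∑ j, r j = k' + 1 := ⟨s + ∑ j, r j - 1, by omega⟩
  rw [hk] at hQ ⊢
  obtain ⟨hPB, c, hc, hx⟩ := Q_thm2 hQ
  have hfe2 : (fun n : ℕ => ab n * ((AR M r s n : ℂ) / n)) =
      fun n => ((abr n * (AR M r s n / n) : ℝ) : ℂ) := by
    funext n; push_cast; rw [abr_cast]
  have hab : ∀ n, 0 ≤ abr n := fun n => by unfold abr; positivity
  have hPB2 : PB (fun n => ((abr n * (AR M r s n / n) : ℝ) : ℂ)) := by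
    rw [← hfe2]
    exact PB_ab.mul hPB.div
  simp only [hfe2] at hx
  have h1 := FIN 2 two_ne_zero (fun n => abr n * (AR M r s n / n))
    (fun n => mul_nonneg (hab n) (div_nonneg (AR_nonneg M r s n) (by positivity)))
    (by simp) hPB2 c (VV_Bd (by norm_num) hc) (VV_zero hc) hx
  rw [← hasSum_nat_add_iff' 1] at h1
  have h2 := Submodule.smul_mem _ (2 : ℚ) (VV_tsum (by norm_num) hc)
  have h3 := h1.tsum_eq
  simp only [Finset.sum_range_one, Nat.cast_zero, div_zero, sub_zero, Nat.cast_ofNat] at h3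
  rw [Rat.smul_def, Rat.cast_ofNat, ← h3] at h2
  convert h2 using 1
  apply tsum_congr
  intro n
  rw [Complex.ofReal_mul, Complex.ofReal_div, AR_succ, abr_cast]
  have hn : (n : ℂ) + 1 ≠ 0 := by exact_mod_cast Nat.succ_ne_zero n
  have hb : (Nat.centralBinom (n+1) : ℂ) ≠ 0 := by exact_mod_cast Nat.centralBinom_ne_zero _
  rw [← Nat.centralBinom_eq_two_mul_choose, ab,
    show (2:ℂ) ^ (4 * (n+1)) = 4 ^ (n+1) * 4 ^ (n+1) by rw [← mul_pow, pow_mul]; norm_num]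
  push_cast
  field_simp
  ring

/-- Central binomial Euler–Apéry-type sums: for `r_1,…,r_M` positive, `s ≥ 1`,
`k = s + r_1 + ⋯ + r_M`,
`∑_{n=1}^∞ 2^{2n} (∏_j H_{n-1}^{(r_j)})/(n^{s+1} C(2n,n)) ∈ 𝔷_{k+1}(2)` and
`∑_{n=1}^∞ 2^{4n} (∏_j H_{n-1}^{(r_j)})/(n^{s+2} C(2n,n)²) ∈ 𝔷_{k+2}(4)`. -/
theorem inverse_binomial_sums_level_two_and_quadratic (M : ℕ) (r : Fin M → ℕ)
    (hr : ∀ j, 0 < r j) (s : ℕ) (hs : 0 < s) :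
    (∑' n : ℕ, (2 : ℂ) ^ (2 * (n + 1)) * (∏ j, (H (r j) n : ℂ)) /
        (((n : ℂ) + 1) ^ (s + 1) * (Nat.choose (2 * (n + 1)) (n + 1) : ℂ)) ∈
      zspan (s + ∑ j, r j + 1) 2) ∧
    (∑' n : ℕ, (2 : ℂ) ^ (4 * (n + 1)) * (∏ j, (H (r j) n : ℂ)) /
        (((n : ℂ) + 1) ^ (s + 2) * ((Nat.choose (2 * (n + 1)) (n + 1) : ℂ)) ^ 2) ∈
      zspan (s + ∑ j, r j + 2) 4) := by
  exact ⟨part1 M r hr s hs, part2 M r hr s hs⟩
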